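/- Let Z_n be the number of protected nodes in the random m-ary search tree 𝒯_n with n keys. If m ≤ 26, then n^{−1/2}(Z_n − E Z_n) converges in distribution as n → ∞ to N(0, σ²), where σ² is some positive constant. Furthermore, E Z_n can be replaced by μ·n, where μ = (1/(m(H_m − 1))) · Σ_{ℓ=0}^{m−1} (m!/(m−ℓ)!) · ((m(m−ℓ))! / (m(m−ℓ)+ℓ+1)!). -/

import Mathlib

open scoped BigOperators

namespace MSTpaper

/-- The marked ordered tree underlying an `m`-ary search tree: a node either holds
`j` keys and has no children (`lf j`, with `j ≤ m - 2`; `lf 0` is an external node),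
or is full, holding `m - 1` keys, and has `m` (possibly external) children. -/
inductive MTree (m : ℕ) : Type
  | lf : ℕ → MTree m
  | nd : (Fin m → MTree m) → MTree m

namespace MTree

/-- The number of keys of an `m`-ary search tree. -/
def keys {m : ℕ} : MTree m → ℕ
  | lf j => j
  | nd c => (m - 1) + ∑ i, keys (c i)

end MTree

/-- The `m`-ary search tree built from a list of (distinct) keys: the first `m - 1`
keys go into the root, and each further key is passed to the subtree corresponding to
the interval (among the intervals determined by the root keys) it belongs to. -/
def build (m : ℕ) (l : List ℕ) : MTree m :=
  if h : 2 ≤ m ∧ m - 1 ≤ l.length then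
    MTree.nd (fun i =>
      build m ((l.drop (m - 1)).filter
        (fun x => (l.take (m - 1)).countP (fun p => decide (p < x)) == (i : ℕ))))
  else MTree.lf l.length
termination_by l.length
decreasing_by
  exact lt_of_le_of_lt (List.length_filter_le _ _) (by rw [List.length_drop]; omega)

open Classical in
/-- The number of fringe subtrees of a tree that are isomorphic (as marked ordered
trees, i.e. equal) to the fixed tree `T`. -/
noncomputable def countEq {m : ℕ} (T : MTree m) : MTree m → ℕ
  | MTree.lf j => if MTree.lf j = T then 1 else 0
  | MTree.nd c => (if MTree.nd c = T then 1 else 0) + ∑ i, countEq T (c i)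

open Classical in
/-- The number of fringe subtrees with exactly `k` keys. -/
noncomputable def countKeys {m : ℕ} (k : ℕ) : MTree m → ℕ
  | MTree.lf j => if j = k then 1 else 0
  | MTree.nd c => (if MTree.keys (MTree.nd c) = k then 1 else 0) + ∑ i, countKeys k (c i)

/-- The random `m`-ary search tree with `n` keys, as a function of the permutation
(the order in which the keys `1, …, n` arrive). -/
def mst (m n : ℕ) (π : Equiv.Perm (Fin n)) : MTree m :=
  build m ((List.finRange n).map (fun i => ((π i : ℕ))))

/-- Expectation of a functional of the random `m`-ary search tree, i.e. the average
over the `n!` (uniformly distributed) permutations. -/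
noncomputable def pexp (n : ℕ) (f : Equiv.Perm (Fin n) → ℝ) : ℝ :=
  (∑ π : Equiv.Perm (Fin n), f π) / (Nat.factorial n : ℝ)

/-- The harmonic number `H_m`. -/
noncomputable def Hm (m : ℕ) : ℝ := ∑ i ∈ Finset.range m, (1 : ℝ) / ((i : ℝ) + 1)

open MeasureTheory in
/-- `W_n` converges in distribution, under the uniformly random permutation model,
to the centered normal distribution with variance `v`. -/
def TendstoGauss (W : (n : ℕ) → Equiv.Perm (Fin n) → ℝ) (v : NNReal) : Prop :=
  ∀ f : BoundedContinuousFunction ℝ ℝ,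
    Filter.Tendsto (fun n => pexp n (fun π => f (W n π)))
      Filter.atTop (nhds (∫ x, f x ∂(ProbabilityTheory.gaussianReal 0 v)))

end MSTpaper

namespace MSTpaper

/-- A tree (regarded as rooted at an internal node) is a leaf if it is internal
(has at least one key) and has no internal children. -/
def IsLeaf {m : ℕ} : MTree m → Prop
  | MTree.lf j => 0 < j
  | MTree.nd c => ∀ i, c i = MTree.lf 0

open Classical in
/-- The number of protected nodes: internal nodes that are not leaves and none of
whose children is a leaf. -/
noncomputable def protCount {m : ℕ} : MTree m → ℕ
  | MTree.lf _ => 0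
  | MTree.nd c =>
      (if (¬ IsLeaf (MTree.nd c)) ∧ (∀ i, ¬ IsLeaf (c i)) then 1 else 0)
        + ∑ i, protCount (c i)

/-- The constant `μ` in the asymptotics of the number of protected nodes. -/
noncomputable def muProt (m : ℕ) : ℝ :=
  (1 / ((m : ℝ) * (Hm m - 1))) *
    ∑ l ∈ Finset.range m,
      ((Nat.factorial m : ℝ) / (Nat.factorial (m - l) : ℝ)) *
        ((Nat.factorial (m * (m - l)) : ℝ) / (Nat.factorial (m * (m - l) + l + 1) : ℝ))

/-- The average of `f` over all orderings of the finite set `S` of cardinality `k`. -/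
noncomputable def avg : ℕ → Finset ℕ → (List ℕ → ℂ) → ℂ
  | 0, _, f => f []
  | k + 1, S, f => (∑ x ∈ S, avg k (S.erase x) (fun l => f (x :: l))) / ((k : ℂ) + 1)

theorem avg_congr {k : ℕ} {S : Finset ℕ} (hS : S.card = k) {f g : List ℕ → ℂ}
    (h : ∀ l : List ℕ, l.Nodup → l.toFinset = S → f l = g l) : avg k S f = avg k S g := by
  induction k generalizing S f g with
  | zero =>
    simp only [avg]
    exact h [] List.nodup_nil (by simpa [eq_comm] using hS)
  | succ k ih =>
    simp only [avg]
    congr 1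
    refine Finset.sum_congr rfl fun x hx => ih ?_ fun l hl hlS => ?_
    · rw [Finset.card_erase_of_mem hx, hS]; rfl
    · refine h _ ?_ ?_
      · refine List.nodup_cons.2 ⟨fun hxl => ?_, hl⟩
        rw [← List.mem_toFinset, hlS] at hxl
        simp at hxl
      · rw [List.toFinset_cons, hlS, Finset.insert_erase hx]

theorem avg_add (k : ℕ) (S : Finset ℕ) (f g : List ℕ → ℂ) :
    avg k S (fun l => f l + g l) = avg k S f + avg k S g := by
  induction k generalizing S f g with
  | zero => simp [avg]
  | succ k ih => simp only [avg, ih, Finset.sum_add_distrib, add_div]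

theorem avg_const {k : ℕ} {S : Finset ℕ} (hS : S.card = k) (c : ℂ) :
    avg k S (fun _ => c) = c := by
  induction k generalizing S with
  | zero => simp [avg]
  | succ k ih =>
    have : ∀ x ∈ S, avg k (S.erase x) (fun _ => c) = c := fun x hx =>
      ih (by rw [Finset.card_erase_of_mem hx, hS]; rfl)
    have h0 : ((k : ℂ) + 1) ≠ 0 := by exact_mod_cast Nat.succ_ne_zero k
    simp only [avg]
    rw [Finset.sum_congr rfl this, Finset.sum_const, hS, nsmul_eq_mul]
    push_cast
    field_simp

theorem avg_mul_left (k : ℕ) (S : Finset ℕ) (c : ℂ) (f : List ℕ → ℂ) :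
    avg k S (fun l => c * f l) = c * avg k S f := by
  induction k generalizing S f with
  | zero => simp [avg]
  | succ k ih => simp only [avg, ih, ← Finset.mul_sum, mul_div_assoc]

theorem avg_sum {ι : Type*} (k : ℕ) (S : Finset ℕ) (s : Finset ι) (f : ι → List ℕ → ℂ) :
    avg k S (fun l => ∑ i ∈ s, f i l) = ∑ i ∈ s, avg k S (f i) := by
  induction k generalizing S f with
  | zero => simp [avg]
  | succ k ih =>
    simp only [avg, ih]
    rw [Finset.sum_comm, Finset.sum_div]

theorem norm_avg_le {k : ℕ} {S : Finset ℕ} (hS : S.card = k) {f : List ℕ → ℂ}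
    (hf : ∀ l, ‖f l‖ ≤ 1) : ‖avg k S f‖ ≤ 1 := by
  induction k generalizing S f with
  | zero => simpa [avg] using hf []
  | succ k ih =>
    simp only [avg]
    have h0 : ‖((k : ℂ) + 1)‖ = (k : ℝ) + 1 := by
      have : ((k : ℂ) + 1) = ((k + 1 : ℕ) : ℂ) := by push_cast; rfl
      rw [this, Complex.norm_natCast]; push_cast; rfl
    rw [norm_div, h0, div_le_one (by positivity)]
    refine (norm_sum_le _ _).trans ?_
    refine (Finset.sum_le_sum fun x hx => ih (S := S.erase x) ?_ fun l => hf _).trans ?_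
    · rw [Finset.card_erase_of_mem hx, hS]; rfl
    · simp [hS]

theorem avg_eq_sum_injective {k : ℕ} {S : Finset ℕ} (f : List ℕ → ℂ) :
    avg k S f = (∑ g ∈ (Fintype.piFinset (fun _ : Fin k => S)).filter Function.Injective,
      f (List.ofFn g)) / (k.factorial : ℂ) := by
  induction k generalizing S f with
  | zero =>
    have : (Fintype.piFinset (fun _ : Fin 0 => S)).filter Function.Injective = {Fin.elim0} := by
      ext g
      simp only [Finset.mem_filter, Fintype.mem_piFinset, Finset.mem_singleton]
      exact ⟨fun _ => Subsingleton.elim _ _,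
        fun _ => ⟨fun i => i.elim0, Function.injective_of_subsingleton g⟩⟩
    rw [this]
    simp [avg]
  | succ k ih =>
    simp only [avg]
    have key : ∑ x ∈ S, ∑ g ∈ (Fintype.piFinset (fun _ : Fin k => S.erase x)).filter
          Function.Injective, f (x :: List.ofFn g)
        = ∑ g ∈ (Fintype.piFinset (fun _ : Fin (k + 1) => S)).filter Function.Injective,
          f (List.ofFn g) := by
      rw [Finset.sum_sigma']
      refine Finset.sum_bij' (fun p _ => Fin.cons p.1 p.2) (fun g _ => ⟨g 0, Fin.tail g⟩)
        ?_ ?_ ?_ ?_ ?_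
      · rintro ⟨x, g⟩ hp
        simp only [Finset.mem_sigma, Finset.mem_filter, Fintype.mem_piFinset,
          Finset.mem_erase] at hp ⊢
        refine ⟨fun i => ?_, Fin.cons_injective_iff.2 ⟨?_, hp.2.2⟩⟩
        · refine Fin.cases ?_ (fun j => ?_) i
          · simpa using hp.1
          · simpa using (hp.2.1 j).2
        · rintro ⟨j, hj⟩
          exact (hp.2.1 j).1 hj
      · intro g hg
        simp only [Finset.mem_sigma, Finset.mem_filter, Fintype.mem_piFinset,
          Finset.mem_erase] at hg ⊢
        refine ⟨hg.1 0, fun j => ⟨fun h => ?_, hg.1 _⟩, fun i j h => ?_⟩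
        · exact Fin.succ_ne_zero j (hg.2 h)
        · exact Fin.succ_injective _ (hg.2 h)
      · rintro ⟨x, g⟩ _
        simp
      · intro g _
        simp
      · rintro ⟨x, g⟩ _
        simp [List.ofFn_succ]
    simp only [ih]
    rw [← Finset.sum_div, key, Nat.factorial_succ]
    push_cast
    rw [div_div, mul_comm]

theorem avg_range (n : ℕ) (f : List ℕ → ℂ) :
    avg n (Finset.range n) f
      = (∑ π : Equiv.Perm (Fin n), f ((List.finRange n).map (fun i => ((π i : ℕ)))))
        / (n.factorial : ℂ) := by
  rw [avg_eq_sum_injective]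
  congr 1
  symm
  refine Finset.sum_bij (fun π _ => fun i => ((π i : ℕ))) ?_ ?_ ?_ ?_
  · intro π _
    simp only [Finset.mem_filter, Fintype.mem_piFinset, Finset.mem_range]
    exact ⟨fun i => (π i).2, Fin.val_injective.comp π.injective⟩
  · intro π _ π' _ h
    ext i
    exact congrFun h i
  · intro g hg
    simp only [Finset.mem_filter, Fintype.mem_piFinset, Finset.mem_range] at hg
    have hinj : Function.Injective (fun i => (⟨g i, hg.1 i⟩ : Fin n)) := fun i j h =>
      hg.2 (congrArg Fin.val h)
    exact ⟨Equiv.ofBijective _ (Finite.injective_iff_bijective.1 hinj), Finset.mem_univ _, rfl⟩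
  · intro π _
    rw [List.ofFn_eq_map]

/-- Splitting an ordering according to a colouring. -/
theorem avg_prod_filter {ι : Type*} [Fintype ι] [DecidableEq ι] (c : ℕ → ι) {k : ℕ}
    {S : Finset ℕ} (hS : S.card = k) (f : ι → List ℕ → ℂ) :
    avg k S (fun l => ∏ i, f i (l.filter (fun x => decide (c x = i))))
      = ∏ i, avg (S.filter (fun x => c x = i)).card (S.filter (fun x => c x = i)) (f i) := by
  induction k generalizing S f with
  | zero =>
    have : S = ∅ := by simpa using hS
    subst this
    simp [avg]
  | succ k ih =>
    simp only [avg]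
    have h0 : ((k : ℂ) + 1) ≠ 0 := by exact_mod_cast Nat.succ_ne_zero k
    set A : ι → ℂ := fun i =>
      avg (S.filter (fun x => c x = i)).card (S.filter (fun x => c x = i)) (f i) with hA
    have step : ∀ x ∈ S,
        avg k (S.erase x) (fun l => ∏ i, f i ((x :: l).filter (fun y => decide (c y = i))))
          = avg ((S.filter (fun y => c y = c x)).card - 1)
              ((S.filter (fun y => c y = c x)).erase x) (fun l => f (c x) (x :: l))
            * ∏ i ∈ Finset.univ.erase (c x), A i := by
      intro x hx
      have h1 := ih (S := S.erase x) (by rw [Finset.card_erase_of_mem hx, hS]; rfl)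
        (Function.update f (c x) (fun l => f (c x) (x :: l)))
      have h2 : (fun l : List ℕ => ∏ i, f i ((x :: l).filter (fun y => decide (c y = i))))
          = fun l => ∏ i, (Function.update f (c x) (fun l => f (c x) (x :: l))) i
              (l.filter (fun y => decide (c y = i))) := by
        funext l
        refine Finset.prod_congr rfl fun i _ => ?_
        by_cases hi : i = c x
        · subst hi; simp
        · rw [Function.update_of_ne hi, List.filter_cons_of_neg (by simpa using Ne.symm hi)]
      rw [h2, h1, ← Finset.mul_prod_erase _ _ (Finset.mem_univ (c x))]
      congr 1
      · rw [Function.update_self, Finset.filter_erase, Finset.card_erase_of_mem (by simp [hx])]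
      · refine Finset.prod_congr rfl fun i hi => ?_
        have hi' : i ≠ c x := (Finset.mem_erase.1 hi).1
        rw [Function.update_of_ne hi', Finset.filter_erase,
          Finset.erase_eq_of_notMem (by simp [Ne.symm hi'])]
    rw [Finset.sum_congr rfl step]
    have hfib : ∀ i, ∑ x ∈ S.filter (fun x => c x = i),
        avg ((S.filter (fun y => c y = c x)).card - 1)
              ((S.filter (fun y => c y = c x)).erase x) (fun l => f (c x) (x :: l))
            * ∏ i ∈ Finset.univ.erase (c x), A i
        = ((S.filter (fun x => c x = i)).card : ℂ) * ∏ i, A i := by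
      intro i
      rw [← Finset.mul_prod_erase _ _ (Finset.mem_univ i), ← mul_assoc]
      have : ∀ x ∈ S.filter (fun x => c x = i),
          avg ((S.filter (fun y => c y = c x)).card - 1)
              ((S.filter (fun y => c y = c x)).erase x) (fun l => f (c x) (x :: l))
            * ∏ i ∈ Finset.univ.erase (c x), A i
          = avg ((S.filter (fun y => c y = i)).card - 1)
              ((S.filter (fun y => c y = i)).erase x) (fun l => f i (x :: l))
            * ∏ i ∈ Finset.univ.erase i, A i := by
        intro x hx
        obtain ⟨-, rfl⟩ := Finset.mem_filter.1 hx
        rfl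
      rw [Finset.sum_congr rfl this, ← Finset.sum_mul]
      congr 1
      rcases hc : (S.filter (fun y => c y = i)).card with _ | r
      · rw [Finset.card_eq_zero] at hc
        simp [hc]
      · simp only [hA, hc, avg]
        have hr : ((r : ℂ) + 1) ≠ 0 := by exact_mod_cast Nat.succ_ne_zero r
        push_cast
        field_simp
    rw [← Finset.sum_fiberwise S c, Finset.sum_congr rfl fun i _ => hfib i, ← Finset.sum_mul,
      ← Nat.cast_sum, ← Finset.card_eq_sum_card_fiberwise (fun _ _ => Finset.mem_univ _), hS]
    push_cast
    field_simp

/-- Conditioning on the set of the first `k` elements of an ordering. -/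
theorem avg_take_drop (k r : ℕ) {S : Finset ℕ} (hS : S.card = r + k)
    (G : Finset ℕ → List ℕ → ℂ) :
    avg (r + k) S (fun l => G (l.take k).toFinset (l.drop k))
      = (∑ R ∈ S.powersetCard k, avg r (S \ R) (G R)) / ((r + k).choose k : ℂ) := by
  induction k generalizing S G with
  | zero => simp
  | succ k ih =>
    rw [show r + (k + 1) = (r + k) + 1 by ring]
    simp only [avg, List.take_succ_cons, List.drop_succ_cons, List.toFinset_cons]
    have h1 : ∀ x ∈ S, avg (r + k) (S.erase x)
        (fun l => G (insert x (l.take k).toFinset) (l.drop k))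
        = (∑ R ∈ (S.erase x).powersetCard k, avg r (S.erase x \ R) (G (insert x R)))
          / ((r + k).choose k : ℂ) := fun x hx =>
      ih (by rw [Finset.card_erase_of_mem hx, hS]; rfl) (fun R l => G (insert x R) l)
    rw [Finset.sum_congr rfl h1, ← Finset.sum_div]
    have h2 : ∑ x ∈ S, ∑ R ∈ (S.erase x).powersetCard k, avg r (S.erase x \ R) (G (insert x R))
        = ∑ R ∈ S.powersetCard (k + 1), ∑ x ∈ R, avg r (S \ R) (G R) := by
      rw [Finset.sum_sigma', Finset.sum_sigma']
      refine Finset.sum_bij' (fun p _ => ⟨insert p.1 p.2, p.1⟩) (fun p _ => ⟨p.2, p.1.erase p.2⟩)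
        ?_ ?_ ?_ ?_ ?_
      · rintro ⟨x, R⟩ h
        simp only [Finset.mem_sigma, Finset.mem_powersetCard, Finset.subset_erase] at h ⊢
        exact ⟨⟨Finset.insert_subset h.1 h.2.1.1, by
          rw [Finset.card_insert_of_notMem h.2.1.2, h.2.2]⟩, Finset.mem_insert_self _ _⟩
      · rintro ⟨R, x⟩ h
        simp only [Finset.mem_sigma, Finset.mem_powersetCard] at h ⊢
        exact ⟨h.1.1 h.2, Finset.erase_subset_erase _ h.1.1, by
          rw [Finset.card_erase_of_mem h.2, h.1.2]; rfl⟩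
      · rintro ⟨x, R⟩ h
        simp only [Finset.mem_sigma, Finset.mem_powersetCard, Finset.subset_erase] at h
        simp [Finset.erase_insert h.2.1.2]
      · rintro ⟨R, x⟩ h
        simp only [Finset.mem_sigma] at h
        simp [Finset.insert_erase h.2]
      · rintro ⟨x, R⟩ h
        simp only
        congr 1
        ext y
        simp only [Finset.mem_sdiff, Finset.mem_erase, Finset.mem_insert]
        tauto
    have h3 : ∀ R ∈ S.powersetCard (k + 1), ∑ x ∈ R, avg r (S \ R) (G R)
        = ((k : ℂ) + 1) * avg r (S \ R) (G R) := by
      intro R hR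
      rw [Finset.sum_const, (Finset.mem_powersetCard.1 hR).2, nsmul_eq_mul]
      push_cast; rfl
    rw [h2, Finset.sum_congr rfl h3, ← Finset.mul_sum]
    have h4 := Nat.add_one_mul_choose_eq (r + k) k
    have h5 : (((r + k : ℕ) : ℂ) + 1) * ((r + k).choose k : ℂ)
        = ((r + k + 1).choose (k + 1) : ℂ) * ((k : ℂ) + 1) := by exact_mod_cast h4
    have h6 : ((r + k).choose k : ℂ) ≠ 0 := by
      exact_mod_cast (Nat.choose_pos (Nat.le_add_left k r)).ne'
    have h7 : ((r + k + 1).choose (k + 1) : ℂ) ≠ 0 := by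
      exact_mod_cast (Nat.choose_pos (by omega)).ne'
    have h8 : ((k : ℂ) + 1) ≠ 0 := by exact_mod_cast Nat.succ_ne_zero k
    have h9 : (((r + k : ℕ) : ℂ) + 1) ≠ 0 := by exact_mod_cast Nat.succ_ne_zero (r + k)
    rw [div_div, div_eq_div_iff (mul_ne_zero h6 h9) h7]
    linear_combination (-(∑ R ∈ S.powersetCard (k + 1), avg r (S \ R) (G R))) * h5

/-- The number of elements of `R` smaller than `x`. -/
def rankIn (R : Finset ℕ) (x : ℕ) : ℕ := (R.filter (fun p => p < x)).card

theorem rankIn_le_card (R : Finset ℕ) (x : ℕ) : rankIn R x ≤ R.card :=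
  Finset.card_filter_le _ _

theorem rankIn_mono (R : Finset ℕ) : Monotone (rankIn R) := fun _ _ h =>
  Finset.card_le_card fun _ hp =>
    Finset.mem_filter.2 ⟨(Finset.mem_filter.1 hp).1, (Finset.mem_filter.1 hp).2.trans_le h⟩

theorem rankIn_lt_of_mem {R : Finset ℕ} {x y : ℕ} (hx : x ∈ R) (h : x < y) :
    rankIn R x < rankIn R y := by
  refine Finset.card_lt_card (Finset.ssubset_iff_subset_ne.2 ⟨fun p hp => ?_, fun he => ?_⟩)
  · exact Finset.mem_filter.2 ⟨(Finset.mem_filter.1 hp).1, (Finset.mem_filter.1 hp).2.trans h⟩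
  · have : x ∈ R.filter (fun p => p < y) := Finset.mem_filter.2 ⟨hx, h⟩
    rw [← he] at this
    simp at this

theorem rankIn_injOn (R : Finset ℕ) : Set.InjOn (rankIn R) R := by
  intro x hx y hy h
  rcases lt_trichotomy x y with hlt | heq | hlt
  · exact absurd h (rankIn_lt_of_mem hx hlt).ne
  · exact heq
  · exact absurd h (rankIn_lt_of_mem hy hlt).ne'

theorem image_rankIn (R : Finset ℕ) : R.image (rankIn R) = Finset.range R.card := by
  refine Finset.eq_of_subset_of_card_le (fun j hj => ?_) ?_
  · obtain ⟨x, hx, rfl⟩ := Finset.mem_image.1 hj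
    exact Finset.mem_range.2 (Finset.card_lt_card (Finset.filter_ssubset.2 ⟨x, hx, lt_irrefl x⟩))
  · rw [Finset.card_image_of_injOn (rankIn_injOn R), Finset.card_range]

/-- The numbers of elements of `S \ R` in the intervals determined by `R`. -/
def gapSizes (m : ℕ) (S R : Finset ℕ) (i : Fin m) : ℕ :=
  ((S \ R).filter (fun x => rankIn R x = (i : ℕ))).card

theorem rankIn_eq_of_mem {m : ℕ} {S R : Finset ℕ} (hR : R ⊆ S) (hm : R.card < m) {x : ℕ}
    (hx : x ∈ R) :
    rankIn S x = rankIn R x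
      + ∑ i ∈ (Finset.univ : Finset (Fin m)).filter (fun i : Fin m => (i : ℕ) ≤ rankIn R x),
          gapSizes m S R i := by
  have h1 : S.filter (fun y => y < x) = R.filter (fun y => y < x)
      ∪ (S \ R).filter (fun y => y < x) := by
    rw [← Finset.filter_union, Finset.union_sdiff_of_subset hR]
  have h2 : Disjoint (R.filter (fun y => y < x)) ((S \ R).filter (fun y => y < x)) :=
    Finset.disjoint_filter_filter Finset.disjoint_sdiff
  have h3 : ((S \ R).filter (fun y => y < x)).card
      = ∑ i ∈ (Finset.univ : Finset (Fin m)).filter (fun i : Fin m => (i : ℕ) ≤ rankIn R x),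
          gapSizes m S R i := by
    have hf : ∀ y ∈ (S \ R).filter (fun y => y < x),
        (⟨rankIn R y, (rankIn_le_card R y).trans_lt hm⟩ : Fin m)
          ∈ (Finset.univ : Finset (Fin m)).filter (fun i : Fin m => (i : ℕ) ≤ rankIn R x) := by
      intro y hy
      simp only [Finset.mem_filter, Finset.mem_univ, true_and]
      exact rankIn_mono R (Finset.mem_filter.1 hy).2.le
    rw [Finset.card_eq_sum_card_fiberwise hf]
    refine Finset.sum_congr rfl fun i hi => ?_
    unfold gapSizes
    congr 1
    ext y
    simp only [Finset.mem_filter, Finset.mem_sdiff, Fin.ext_iff, Finset.mem_univ, true_and] at hi ⊢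
    constructor
    · rintro ⟨⟨h, -⟩, h'⟩
      exact ⟨h, h'⟩
    · rintro ⟨h, h'⟩
      refine ⟨⟨h, ?_⟩, h'⟩
      by_contra hlt
      have hne : x ≠ y := fun he => h.2 (he ▸ hx)
      have := rankIn_lt_of_mem hx (lt_of_le_of_ne (not_lt.1 hlt) hne)
      omega
  unfold rankIn at h3 ⊢
  rw [h1, Finset.card_union_of_disjoint h2, h3]

theorem gapSizes_injOn {m : ℕ} (hm : 1 ≤ m) (S : Finset ℕ) :
    Set.InjOn (gapSizes m S) (S.powersetCard (m - 1)) := by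
  intro R hR R' hR' h
  have key : ∀ Q ∈ S.powersetCard (m - 1), Q.image (rankIn S)
      = (Finset.range (m - 1)).image (fun j => j
        + ∑ i ∈ (Finset.univ : Finset (Fin m)).filter (fun i : Fin m => (i : ℕ) ≤ j),
          gapSizes m S Q i) := by
    intro Q hQ
    obtain ⟨hQS, hQc⟩ := Finset.mem_powersetCard.1 hQ
    rw [← hQc, ← image_rankIn, Finset.image_image]
    exact Finset.image_congr fun x hx => rankIn_eq_of_mem hQS (by omega) hx
  have h1 : R.image (rankIn S) = R'.image (rankIn S) := by
    rw [key R hR, key R' hR', h]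
  have hs : ∀ Q ∈ S.powersetCard (m - 1), ∀ x, x ∈ Q ↔ x ∈ S ∧ rankIn S x ∈ Q.image (rankIn S) := by
    intro Q hQ x
    have hQS := (Finset.mem_powersetCard.1 hQ).1
    constructor
    · exact fun hx => ⟨hQS hx, Finset.mem_image_of_mem _ hx⟩
    · rintro ⟨hx, hi⟩
      obtain ⟨y, hy, hxy⟩ := Finset.mem_image.1 hi
      exact rankIn_injOn S (hQS hy) hx hxy ▸ hy
  ext x
  rw [hs R hR, hs R' hR', h1]

theorem card_piAntidiag_fin (m N : ℕ) (hm : 1 ≤ m) :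
    (Finset.piAntidiag (Finset.univ : Finset (Fin m)) N).card = (N + (m - 1)).choose (m - 1) := by
  rw [← Finset.map_sym_eq_piAntidiag, Finset.card_map, Finset.sym_univ, Finset.card_univ,
    Sym.card_sym_eq_choose, Fintype.card_fin, ← Nat.choose_symm_add]
  congr 1
  omega

theorem sum_gapSizes {m r : ℕ} (hm : 1 ≤ m) {S R : Finset ℕ} (hS : S.card = r + (m - 1))
    (hR : R ∈ S.powersetCard (m - 1)) : ∑ i, gapSizes m S R i = r := by
  obtain ⟨hRS, hRc⟩ := Finset.mem_powersetCard.1 hR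
  have h1 : (S \ R).card = r := by rw [Finset.card_sdiff_of_subset hRS]; omega
  have hf : ∀ y ∈ S \ R, (⟨rankIn R y, (rankIn_le_card R y).trans_lt (by omega)⟩ : Fin m)
          ∈ (Finset.univ : Finset (Fin m)) := fun _ _ => Finset.mem_univ _
  rw [← h1, Finset.card_eq_sum_card_fiberwise hf]
  refine Finset.sum_congr rfl fun i _ => ?_
  unfold gapSizes
  simp only [Fin.ext_iff]

theorem sum_powersetCard_gapSizes {m r : ℕ} (hm : 1 ≤ m) {S : Finset ℕ}
    (hS : S.card = r + (m - 1)) (H : (Fin m → ℕ) → ℂ) :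
    ∑ R ∈ S.powersetCard (m - 1), H (gapSizes m S R)
      = ∑ I ∈ Finset.piAntidiag (Finset.univ : Finset (Fin m)) r, H I := by
  have himg : (S.powersetCard (m - 1)).image (gapSizes m S)
      = Finset.piAntidiag (Finset.univ : Finset (Fin m)) r := by
    refine Finset.eq_of_subset_of_card_le (fun I hI => ?_) ?_
    · obtain ⟨R, hR, rfl⟩ := Finset.mem_image.1 hI
      simp [Finset.mem_piAntidiag, sum_gapSizes hm hS hR]
    · rw [Finset.card_image_of_injOn (gapSizes_injOn hm S), Finset.card_powersetCard, hS,
        card_piAntidiag_fin m r hm]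
  rw [← himg, Finset.sum_image (gapSizes_injOn hm S)]

/-- The keys passed to the `i`-th subtree of the root. -/
def part (m : ℕ) (l : List ℕ) (i : Fin m) : List ℕ :=
  (l.drop (m - 1)).filter
    (fun x => (l.take (m - 1)).countP (fun p => decide (p < x)) == (i : ℕ))

theorem build_of_le {m : ℕ} (hm : 2 ≤ m) {l : List ℕ} (hl : m - 1 ≤ l.length) :
    build m l = MTree.nd (fun i => build m (part m l i)) := by
  rw [build, dif_pos ⟨hm, hl⟩]
  rfl

theorem build_of_lt {m : ℕ} {l : List ℕ} (hl : l.length < m - 1) :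
    build m l = MTree.lf l.length := by
  rw [build, dif_neg (by omega)]

theorem length_part_lt {m : ℕ} (hm : 2 ≤ m) {l : List ℕ} (hl : m - 1 ≤ l.length) (i : Fin m) :
    (part m l i).length < l.length := by
  refine lt_of_le_of_lt (List.length_filter_le _ _) ?_
  rw [List.length_drop]; omega

theorem part_map {m : ℕ} {φ : ℕ → ℕ} {l : List ℕ} (hφ : StrictMonoOn φ {x | x ∈ l}) (i : Fin m) :
    part m (l.map φ) i = (part m l i).map φ := by
  unfold part
  rw [← List.map_drop, ← List.map_take, List.filter_map]
  congr 1
  refine List.filter_congr fun x hx => ?_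
  simp only [Function.comp, List.countP_map]
  congr 1
  refine List.countP_congr fun p hp => ?_
  simp [hφ.lt_iff_lt (List.mem_of_mem_take hp) (List.mem_of_mem_drop hx)]

theorem build_map {m : ℕ} {φ : ℕ → ℕ} {l : List ℕ} (hφ : StrictMonoOn φ {x | x ∈ l}) :
    build m (l.map φ) = build m l := by
  induction hn : l.length using Nat.strong_induction_on generalizing l with
  | _ n ih =>
    by_cases h : 2 ≤ m ∧ m - 1 ≤ l.length
    · rw [build_of_le h.1 h.2, build_of_le h.1 (by simpa using h.2)]
      congr 1
      funext i
      rw [part_map hφ]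
      refine ih _ (hn ▸ length_part_lt h.1 h.2 i) (hφ.mono fun x hx => ?_) rfl
      exact List.mem_of_mem_drop (List.mem_of_mem_filter hx)
    · rw [build, dif_neg (by simpa using h), build, dif_neg h, List.length_map]

theorem avg_image {k : ℕ} {S : Finset ℕ} {φ : ℕ → ℕ} (hφ : Set.InjOn φ S) (f : List ℕ → ℂ) :
    avg k (S.image φ) f = avg k S (fun l => f (l.map φ)) := by
  induction k generalizing S f with
  | zero => simp [avg]
  | succ k ih =>
    simp only [avg]
    rw [Finset.sum_image hφ]
    congr 1
    refine Finset.sum_congr rfl fun x hx => ?_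
    have h1 : (S.image φ).erase (φ x) = (S.erase x).image φ := by
      ext y
      simp only [Finset.mem_erase, Finset.mem_image]
      constructor
      · rintro ⟨hy, z, hz, rfl⟩
        exact ⟨z, ⟨fun h => hy (h ▸ rfl), hz⟩, rfl⟩
      · rintro ⟨z, ⟨hzx, hz⟩, rfl⟩
        exact ⟨fun h => hzx (hφ hz hx h), z, hz, rfl⟩
    rw [h1, ih (hφ.mono (Finset.coe_subset.2 (Finset.erase_subset _ _)))]
    simp

/-- The expectation of a functional of the random `m`-ary search tree with `n` keys. -/
noncomputable def treeAvg (m n : ℕ) (g : MTree m → ℂ) : ℂ :=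
  avg n (Finset.range n) (fun l => g (build m l))

theorem avg_build {m k : ℕ} {S : Finset ℕ} (hS : S.card = k) (g : MTree m → ℂ) :
    avg k S (fun l => g (build m l)) = treeAvg m k g := by
  have h1 : Finset.range k = S.image (rankIn S) := by rw [image_rankIn, hS]
  rw [treeAvg, h1, avg_image (rankIn_injOn S)]
  refine avg_congr hS fun l _ hl => ?_
  rw [build_map]
  intro x hx y hy hxy
  refine rankIn_lt_of_mem ?_ hxy
  rw [← hl]
  exact List.mem_toFinset.2 hx

theorem countP_eq_rankIn {l : List ℕ} (hl : l.Nodup) (x : ℕ) :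
    l.countP (fun p => decide (p < x)) = rankIn l.toFinset x := by
  rw [rankIn, List.countP_eq_length_filter, ← List.toFinset_card_of_nodup (hl.filter _),
    List.toFinset_filter]
  simp

/-- The decomposition of the random `m`-ary search tree at the root. -/
theorem avg_split {m n : ℕ} (hm : 2 ≤ m) (hn : m - 1 ≤ n) (Ψ : List ℕ → ℂ)
    (f : (Fin m → ℕ) → Fin m → MTree m → ℂ)
    (h : ∀ l : List ℕ, l.length = n → Ψ l
      = ∏ i, f (fun j => (part m l j).length) i (build m (part m l i))) :
    avg n (Finset.range n) Ψ
      = (∑ I ∈ Finset.piAntidiag (Finset.univ : Finset (Fin m)) (n - (m - 1)),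
      ∏ i, treeAvg m (I i) (f I i)) / (n.choose (m - 1) : ℂ) := by
  obtain ⟨r, rfl⟩ : ∃ r, n = r + (m - 1) := ⟨n - (m - 1), by omega⟩
  set S := Finset.range (r + (m - 1)) with hS
  have hSc : S.card = r + (m - 1) := Finset.card_range _
  let col : Finset ℕ → ℕ → Fin m := fun R x => ⟨min (rankIn R x) (m - 1), by omega⟩
  have hcol : ∀ R : Finset ℕ, R.card = m - 1 → ∀ x i, col R x = i ↔ rankIn R x = (i : ℕ) := by
    intro R hR x i
    have := rankIn_le_card R x
    simp only [col, Fin.ext_iff]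
    omega
  let G : Finset ℕ → List ℕ → ℂ := fun R l' => ∏ i, f (gapSizes m S R) i
    (build m (l'.filter (fun x => decide (col R x = i))))
  have h1 : avg (r + (m - 1)) S Ψ = avg (r + (m - 1)) S (fun l =>
      G (l.take (m - 1)).toFinset (l.drop (m - 1))) := by
    refine avg_congr hSc fun l hl hlS => ?_
    have hlen : l.length = r + (m - 1) := by
      rw [← List.toFinset_card_of_nodup hl, hlS, hSc]
    have htake : (l.take (m - 1)).Nodup := hl.sublist (List.take_sublist _ _)
    have hdrop : (l.drop (m - 1)).Nodup := hl.sublist (List.drop_sublist _ _)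
    have hcard : (l.take (m - 1)).toFinset.card = m - 1 := by
      rw [List.toFinset_card_of_nodup htake, List.length_take]; omega
    have hp : ∀ i, part m l i = (l.drop (m - 1)).filter
        (fun x => decide (col (l.take (m - 1)).toFinset x = i)) := by
      intro i
      refine List.filter_congr fun x _ => ?_
      rw [countP_eq_rankIn htake, Bool.eq_iff_iff]
      simp [hcol _ hcard]
    have hsd : S \ (l.take (m - 1)).toFinset = (l.drop (m - 1)).toFinset := by
      have hdisj : List.Disjoint (l.take (m - 1)) (l.drop (m - 1)) := by
        have := hl
        rw [← List.take_append_drop (m - 1) l] at this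
        exact List.disjoint_of_nodup_append this
      rw [← hlS]
      conv_lhs => rw [← List.take_append_drop (m - 1) l]
      rw [List.toFinset_append, List.take_append_drop, Finset.union_sdiff_cancel_left]
      rwa [List.disjoint_toFinset_iff_disjoint]
    have hg : (fun j => (part m l j).length) = gapSizes m S (l.take (m - 1)).toFinset := by
      funext j
      rw [gapSizes, hsd, hp j, ← List.toFinset_card_of_nodup (hdrop.filter _), List.toFinset_filter]
      congr 1
      refine Finset.filter_congr fun x _ => ?_
      simp [hcol _ hcard]
    rw [h l hlen, hg]
    exact Finset.prod_congr rfl fun i _ => by rw [hp i]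
  rw [h1, avg_take_drop (m - 1) r hSc G, Nat.add_sub_cancel]
  congr 1
  rw [← sum_powersetCard_gapSizes (by omega) hSc (fun I => ∏ i, treeAvg m (I i) (f I i))]
  refine Finset.sum_congr rfl fun R hR => ?_
  obtain ⟨hRS, hRc⟩ := Finset.mem_powersetCard.1 hR
  rw [avg_prod_filter (col R) (by rw [Finset.card_sdiff_of_subset hRS, hSc, hRc]; omega)
    (fun i l => f (gapSizes m S R) i (build m l))]
  refine Finset.prod_congr rfl fun i _ => ?_
  have h2 : ((S \ R).filter (fun x => col R x = i)).card = gapSizes m S R i := by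
    rw [gapSizes]
    congr 1
    exact Finset.filter_congr fun x _ => hcol R hRc x i
  rw [h2]
  exact avg_build h2 _

theorem sum_length_part {m n : ℕ} (hm : 2 ≤ m) {l : List ℕ} (hl : l.length = n) :
    ∑ i, (part m l i).length = n - (m - 1) := by
  have key : ∀ (q : List ℕ) (c : ℕ → Fin m),
      ∑ i, (q.filter (fun x => decide (c x = i))).length = q.length := by
    intro q c
    induction q with
    | nil => simp
    | cons a q ih =>
      have : ∀ i, ((a :: q).filter (fun x => decide (c x = i))).length
          = (if c a = i then 1 else 0) + (q.filter (fun x => decide (c x = i))).length := by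
        intro i
        by_cases hi : c a = i
        · simp [hi, add_comm]
        · simp [hi]
      rw [Finset.sum_congr rfl fun i _ => this i, Finset.sum_add_distrib, ih]
      simp [add_comm]
  have hle : ∀ x, (l.take (m - 1)).countP (fun p => decide (p < x)) < m := fun x =>
    (List.countP_le_length.trans (List.length_take_le _ _)).trans_lt (by omega)
  have h2 := key (l.drop (m - 1)) (fun x => ⟨_, hle x⟩)
  rw [List.length_drop, hl] at h2
  rw [← h2]
  refine Finset.sum_congr rfl fun i _ => ?_
  unfold part
  congr 1
  refine List.filter_congr fun x _ => ?_
  rw [Bool.eq_iff_iff]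
  simp [Fin.ext_iff]

theorem build_eq_lf_zero_iff {m : ℕ} (hm : 2 ≤ m) (l : List ℕ) :
    build m l = MTree.lf 0 ↔ l.length = 0 := by
  by_cases h : m - 1 ≤ l.length
  · rw [build_of_le hm h]
    simp only [reduceCtorEq, false_iff]
    omega
  · rw [build_of_lt (not_le.1 h)]
    simp

theorem isLeaf_build_iff {m : ℕ} (hm : 2 ≤ m) (l : List ℕ) :
    IsLeaf (build m l) ↔ 1 ≤ l.length ∧ l.length ≤ m - 1 := by
  by_cases h : m - 1 ≤ l.length
  · rw [build_of_le hm h]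
    have hs := sum_length_part hm (l := l) rfl
    simp only [IsLeaf, build_eq_lf_zero_iff hm]
    constructor
    · intro h0
      simp only [h0, Finset.sum_const_zero] at hs
      omega
    · rintro ⟨-, h2⟩ i
      have : ∑ i, (part m l i).length = 0 := by omega
      exact (Finset.sum_eq_zero_iff.1 this) i (Finset.mem_univ i)
  · rw [build_of_lt (not_le.1 h)]
    simp only [IsLeaf]
    omega

open Classical in
/-- The indicator that the root is protected, as a function of the sizes of the subtrees. -/
noncomputable def toll (m : ℕ) (I : Fin m → ℕ) : ℕ :=
  if (∑ i, I i) ≠ 0 ∧ ∀ i, ¬ (1 ≤ I i ∧ I i ≤ m - 1) then 1 else 0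

theorem toll_le_one (m : ℕ) (I : Fin m → ℕ) : toll m I ≤ 1 := by
  unfold toll; split_ifs <;> simp

theorem protCount_build_of_le {m : ℕ} (hm : 2 ≤ m) {l : List ℕ} (hl : m - 1 ≤ l.length) :
    protCount (build m l)
      = toll m (fun i => (part m l i).length) + ∑ i, protCount (build m (part m l i)) := by
  have h1 := isLeaf_build_iff hm l
  have hs := sum_length_part hm (l := l) rfl
  rw [build_of_le hm hl] at h1
  rw [build_of_le hm hl, protCount, toll]
  congr 1
  simp only [isLeaf_build_iff hm, h1]
  congr 1
  rw [eq_iff_iff]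
  refine and_congr_left fun _ => ?_
  rw [hs]
  omega

/-- The average over the sizes of the subtrees of the root. -/
noncomputable def compAvg {E : Type*} [AddCommGroup E] [Module ℝ E] (m n : ℕ)
    (H : (Fin m → ℕ) → E) : E :=
  ((n.choose (m - 1) : ℝ))⁻¹ •
    ∑ I ∈ Finset.piAntidiag (Finset.univ : Finset (Fin m)) (n - (m - 1)), H I

section compAvg

variable {E : Type*} [AddCommGroup E] [Module ℝ E] {m n : ℕ}

theorem compAvg_congr {H H' : (Fin m → ℕ) → E}
    (h : ∀ I : Fin m → ℕ, ∑ i, I i = n - (m - 1) → H I = H' I) :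
    compAvg m n H = compAvg m n H' := by
  unfold compAvg
  congr 1
  exact Finset.sum_congr rfl fun I hI => h I (Finset.mem_piAntidiag.1 hI).1

theorem compAvg_add (H H' : (Fin m → ℕ) → E) :
    compAvg m n (fun I => H I + H' I) = compAvg m n H + compAvg m n H' := by
  simp only [compAvg, Finset.sum_add_distrib, smul_add]

theorem compAvg_sub (H H' : (Fin m → ℕ) → E) :
    compAvg m n (fun I => H I - H' I) = compAvg m n H - compAvg m n H' := by
  simp only [compAvg, Finset.sum_sub_distrib, smul_sub]

theorem compAvg_sum {ι : Type*} (s : Finset ι) (H : ι → (Fin m → ℕ) → E) :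
    compAvg m n (fun I => ∑ j ∈ s, H j I) = ∑ j ∈ s, compAvg m n (H j) := by
  simp only [compAvg]
  rw [Finset.sum_comm, Finset.smul_sum]

theorem compAvg_const (hm : 2 ≤ m) (hn : m - 1 ≤ n) (c : E) :
    compAvg m n (fun _ => c) = c := by
  have h0 : (n.choose (m - 1) : ℝ) ≠ 0 := by exact_mod_cast (Nat.choose_pos hn).ne'
  rw [compAvg, Finset.sum_const, card_piAntidiag_fin m _ (by omega), Nat.sub_add_cancel hn,
    ← Nat.cast_smul_eq_nsmul ℝ, smul_smul, inv_mul_cancel₀ h0, one_smul]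

theorem compAvg_mul_left {A : Type*} [Ring A] [Algebra ℝ A] (c : A) (H : (Fin m → ℕ) → A) :
    compAvg m n (fun I => c * H I) = c * compAvg m n H := by
  simp only [compAvg, ← Finset.mul_sum, mul_smul_comm]

theorem compAvg_ofReal (H : (Fin m → ℕ) → ℝ) :
    compAvg m n (fun I => (H I : ℂ)) = ((compAvg m n H : ℝ) : ℂ) := by
  simp [compAvg]

theorem norm_compAvg_le {F : Type*} [NormedAddCommGroup F] [NormedSpace ℝ F]
    {H : (Fin m → ℕ) → F} {K : (Fin m → ℕ) → ℝ}
    (h : ∀ I : Fin m → ℕ, ∑ i, I i = n - (m - 1) → ‖H I‖ ≤ K I) :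
    ‖compAvg m n H‖ ≤ compAvg m n K := by
  unfold compAvg
  rw [norm_smul, Real.norm_of_nonneg (by positivity), smul_eq_mul]
  refine mul_le_mul_of_nonneg_left ?_ (by positivity)
  exact (norm_sum_le _ _).trans
    (Finset.sum_le_sum fun I hI => h I (Finset.mem_piAntidiag.1 hI).1)

theorem compAvg_nonneg {H : (Fin m → ℕ) → ℝ} (h : ∀ I, 0 ≤ H I) : 0 ≤ compAvg m n H := by
  unfold compAvg
  rw [smul_eq_mul]
  exact mul_nonneg (by positivity) (Finset.sum_nonneg fun I _ => h I)

end compAvg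

theorem avg_split_compAvg {m n : ℕ} (hm : 2 ≤ m) (hn : m - 1 ≤ n) (Ψ : List ℕ → ℂ)
    (f : (Fin m → ℕ) → Fin m → MTree m → ℂ)
    (h : ∀ l : List ℕ, l.length = n → Ψ l
      = ∏ i, f (fun j => (part m l j).length) i (build m (part m l i))) :
    avg n (Finset.range n) Ψ = compAvg m n (fun I => ∏ i, treeAvg m (I i) (f I i)) := by
  rw [avg_split hm hn Ψ f h, compAvg, Complex.real_smul, div_eq_inv_mul]
  push_cast
  rfl

/-- The expected number of protected nodes. -/
noncomputable def meanProt (m n : ℕ) : ℝ :=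
  pexp n (fun π => (protCount (mst m n π) : ℝ))

theorem treeAvg_eq_sum (m n : ℕ) (g : MTree m → ℂ) :
    treeAvg m n g = (∑ π : Equiv.Perm (Fin n), g (mst m n π)) / (n.factorial : ℂ) := by
  rw [treeAvg, avg_range]
  rfl

theorem treeAvg_const {m n : ℕ} (c : ℂ) : treeAvg m n (fun _ => c) = c :=
  avg_const (Finset.card_range n) c

theorem ofReal_meanProt (m n : ℕ) :
    (meanProt m n : ℂ) = treeAvg m n (fun T => (protCount T : ℂ)) := by
  rw [treeAvg_eq_sum, meanProt, pexp]
  push_cast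
  rfl

theorem treeAvg_of_lt {m n : ℕ} (hn : n < m - 1) (g : MTree m → ℂ) :
    treeAvg m n g = g (MTree.lf n) := by
  rw [treeAvg, avg_congr (Finset.card_range n) (g := fun _ => g (MTree.lf n)),
    avg_const (Finset.card_range n)]
  intro l hl hS
  have hlen : l.length = n := by
    rw [← List.toFinset_card_of_nodup hl, hS, Finset.card_range]
  rw [build_of_lt (by omega), hlen]

theorem meanProt_of_lt {m n : ℕ} (hn : n < m - 1) : meanProt m n = 0 := by
  have := ofReal_meanProt m n
  rw [treeAvg_of_lt hn] at this
  simpa [protCount] using this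

theorem meanProt_rec {m n : ℕ} (hm : 2 ≤ m) (hn : m - 1 ≤ n) :
    meanProt m n = compAvg m n (fun I => (toll m I : ℝ) + ∑ i, meanProt m (I i)) := by
  have i0 : Fin m := ⟨0, by omega⟩
  have h1 : (meanProt m n : ℂ) = avg n (Finset.range n) (fun l =>
      (toll m (fun i => (part m l i).length) : ℂ)
        + ∑ i, (protCount (build m (part m l i)) : ℂ)) := by
    rw [ofReal_meanProt]
    refine avg_congr (Finset.card_range n) fun l hl hS => ?_
    have hlen : l.length = n := by
      rw [← List.toFinset_card_of_nodup hl, hS, Finset.card_range]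
    beta_reduce
    rw [protCount_build_of_le hm (l := l) (by omega)]
    push_cast
    rfl
  have h2 : avg n (Finset.range n) (fun l => (toll m (fun i => (part m l i).length) : ℂ))
      = compAvg m n (fun I => (toll m I : ℂ)) := by
    rw [avg_split_compAvg hm hn _
      (fun I i _ => if i = i0 then (toll m I : ℂ) else 1) fun l _ => by simp]
    simp [treeAvg_const]
  have h3 : ∀ j, avg n (Finset.range n) (fun l => (protCount (build m (part m l j)) : ℂ))
      = compAvg m n (fun I => (meanProt m (I j) : ℂ)) := by
    intro j
    rw [avg_split_compAvg hm hn _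
      (fun _ i T => if i = j then (protCount T : ℂ) else 1) fun l _ => by simp]
    refine compAvg_congr fun I _ => ?_
    rw [Finset.prod_eq_single j]
    · simp [ofReal_meanProt]
    · intro i _ hi
      simp [hi, treeAvg_const]
    · simp
  have h4 : (meanProt m n : ℂ)
      = compAvg m n (fun I => (((toll m I : ℝ) + ∑ i, meanProt m (I i) : ℝ) : ℂ)) := by
    rw [h1, avg_add, h2, avg_sum, Finset.sum_congr rfl fun j _ => h3 j, ← compAvg_sum,
      ← compAvg_add]
    push_cast
    rfl
  rw [compAvg_ofReal] at h4
  exact_mod_cast h4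

/-- The difference between the conditional and the unconditional expectation. -/
noncomputable def meanDiff (m n : ℕ) (I : Fin m → ℕ) : ℝ :=
  (toll m I : ℝ) + ∑ i, meanProt m (I i) - meanProt m n

theorem compAvg_meanDiff {m n : ℕ} (hm : 2 ≤ m) (hn : m - 1 ≤ n) :
    compAvg m n (meanDiff m n) = 0 := by
  have : compAvg m n (meanDiff m n)
      = compAvg m n (fun I => (toll m I : ℝ) + ∑ i, meanProt m (I i))
        - compAvg m n (fun _ => meanProt m n) := by
    rw [← compAvg_sub]; rfl
  rw [this, compAvg_const hm hn, ← meanProt_rec hm hn, sub_self]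

/-- The characteristic function of the centred number of protected nodes. -/
noncomputable def cf (m n : ℕ) (t : ℝ) : ℂ :=
  treeAvg m n (fun T => Complex.exp (((t * ((protCount T : ℝ) - meanProt m n) : ℝ) : ℂ)
    * Complex.I))

theorem norm_cf_le (m n : ℕ) (t : ℝ) : ‖cf m n t‖ ≤ 1 :=
  norm_avg_le (Finset.card_range n) fun _ => (Complex.norm_exp_ofReal_mul_I _).le

theorem cf_of_lt {m n : ℕ} (hn : n < m - 1) (t : ℝ) : cf m n t = 1 := by
  rw [cf, treeAvg_of_lt hn, meanProt_of_lt hn]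
  simp [protCount]

theorem cf_rec {m n : ℕ} (hm : 2 ≤ m) (hn : m - 1 ≤ n) (t : ℝ) :
    cf m n t = compAvg m n (fun I =>
      Complex.exp (((t * meanDiff m n I : ℝ) : ℂ) * Complex.I) * ∏ i, cf m (I i) t) := by
  have i0 : Fin m := ⟨0, by omega⟩
  have h1 : cf m n t = avg n (Finset.range n) (fun l =>
      Complex.exp (((t * meanDiff m n (fun i => (part m l i).length) : ℝ) : ℂ) * Complex.I)
        * ∏ i, Complex.exp (((t * ((protCount (build m (part m l i)) : ℝ)
          - meanProt m (part m l i).length) : ℝ) : ℂ) * Complex.I)) := by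
    refine avg_congr (Finset.card_range n) fun l hl hS => ?_
    have hlen : l.length = n := by
      rw [← List.toFinset_card_of_nodup hl, hS, Finset.card_range]
    beta_reduce
    rw [protCount_build_of_le hm (l := l) (by omega), ← Complex.exp_sum, ← Complex.exp_add,
      ← Finset.sum_mul, ← add_mul, ← Complex.ofReal_sum, ← Complex.ofReal_add, ← Finset.mul_sum,
      ← mul_add, meanDiff, Finset.sum_sub_distrib]
    congr 4
    push_cast
    ring
  rw [h1, avg_split_compAvg hm hn _ (fun I i T =>
    (if i = i0 then Complex.exp (((t * meanDiff m n I : ℝ) : ℂ) * Complex.I) else 1)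
      * Complex.exp (((t * ((protCount T : ℝ) - meanProt m (I i)) : ℝ) : ℂ) * Complex.I))
    fun _ _ => by
      simp only [Finset.prod_mul_distrib, Finset.prod_ite_eq', Finset.mem_univ, if_true]]
  refine compAvg_congr fun I _ => ?_
  have h2 : ∀ i, treeAvg m (I i) (fun T =>
    (if i = i0 then Complex.exp (((t * meanDiff m n I : ℝ) : ℂ) * Complex.I) else 1)
      * Complex.exp (((t * ((protCount T : ℝ) - meanProt m (I i)) : ℝ) : ℂ) * Complex.I))
      = (if i = i0 then Complex.exp (((t * meanDiff m n I : ℝ) : ℂ) * Complex.I) else 1)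
        * cf m (I i) t := fun i => avg_mul_left _ _ _ _
  rw [Finset.prod_congr rfl fun i _ => h2 i, Finset.prod_mul_distrib]
  simp

/-- The sequence `x` is `O((n + 1) ^ β)`. -/
def PolyBdd {E : Type*} [Norm E] (β : ℝ) (x : ℕ → E) : Prop :=
  ∃ C : ℝ, ∀ n, ‖x n‖ ≤ C * ((n : ℝ) + 1) ^ β

/-- The operator `(1 - z) d/dz` on power series. -/
noncomputable def theta : Module.End ℂ (PowerSeries ℂ) :=
  (LinearMap.mulLeft ℂ (1 - PowerSeries.X)).comp
    (PowerSeries.derivative ℂ : PowerSeries ℂ →ₗ[ℂ] PowerSeries ℂ)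

theorem theta_apply (x : PowerSeries ℂ) :
    theta x = (1 - PowerSeries.X) * PowerSeries.derivative ℂ x := rfl

theorem coeff_theta (x : PowerSeries ℂ) (n : ℕ) :
    PowerSeries.coeff n (theta x)
      = ((n : ℂ) + 1) * PowerSeries.coeff (n + 1) x - n * PowerSeries.coeff n x := by
  rw [theta_apply, sub_mul, one_mul, map_sub, PowerSeries.coeff_derivative]
  cases n with
  | zero => simp
  | succ k =>
    rw [PowerSeries.coeff_succ_X_mul, PowerSeries.coeff_derivative]
    push_cast
    ring

theorem coeff_theta_sub (l : ℂ) (x : PowerSeries ℂ) (n : ℕ) :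
    PowerSeries.coeff n (theta x - l • x)
      = ((n : ℂ) + 1) * PowerSeries.coeff (n + 1) x - (n + l) * PowerSeries.coeff n x := by
  rw [map_sub, coeff_theta, map_smul, smul_eq_mul]
  ring

theorem one_le_add_one_rpow {β : ℝ} (hβ : 0 ≤ β) (n : ℕ) : 1 ≤ ((n : ℝ) + 1) ^ β :=
  Real.one_le_rpow (by linarith [n.cast_nonneg (α := ℝ)]) hβ

theorem succ_rpow_lower {β : ℝ} (hβ : 0 ≤ β) (n : ℕ) :
    ((n : ℝ) + 1) ^ β * (1 + β / (n + 2)) ≤ ((n : ℝ) + 2) ^ β := by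
  have hn : (0 : ℝ) ≤ n := n.cast_nonneg
  have h1 : ((n : ℝ) + 2) = (n + 1) * ((n + 2) / (n + 1)) := by field_simp
  have hpos : 0 < ((n : ℝ) + 2) / (n + 1) := by positivity
  rw [show ((n : ℝ) + 2) ^ β = (n + 1) ^ β * ((n + 2) / (n + 1)) ^ β by
    rw [← Real.mul_rpow (by positivity) hpos.le, ← h1]]
  refine mul_le_mul_of_nonneg_left ?_ (by positivity)
  rw [Real.rpow_def_of_pos hpos]
  have h2 : 1 / ((n : ℝ) + 2) ≤ Real.log ((n + 2) / (n + 1)) := by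
    have := Real.one_sub_inv_le_log_of_pos hpos
    have h3 : 1 - (((n : ℝ) + 2) / (n + 1))⁻¹ = 1 / (n + 2) := by field_simp; ring
    linarith
  have h4 := Real.add_one_le_exp (Real.log (((n : ℝ) + 2) / (n + 1)) * β)
  have h5 : 1 / ((n : ℝ) + 2) * β ≤ Real.log ((n + 2) / (n + 1)) * β :=
    mul_le_mul_of_nonneg_right h2 hβ
  have h6 : β / ((n : ℝ) + 2) = 1 / ((n : ℝ) + 2) * β := by ring
  linarith

theorem eventually_norm_add_le {l : ℂ} {a : ℝ} (h : l.re < a) :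
    ∀ᶠ n : ℕ in Filter.atTop, ‖(n : ℂ) + l‖ ≤ n + a := by
  have ht := tendsto_natCast_atTop_atTop (R := ℝ)
  have hd : 0 < a - l.re := by linarith
  filter_upwards [ht.eventually_ge_atTop (-a),
    ht.eventually_ge_atTop ((l.re ^ 2 + l.im ^ 2) / (2 * (a - l.re)))] with n h1 h2
  refine abs_le_of_sq_le_sq' ?_ (by linarith) |>.2
  rw [← Complex.normSq_eq_norm_sq, Complex.normSq_apply]
  simp only [Complex.add_re, Complex.natCast_re, Complex.add_im, Complex.natCast_im, zero_add]
  rw [div_le_iff₀ (by positivity)] at h2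
  nlinarith [sq_nonneg a]

theorem polyBdd_of_theta_sub {β : ℝ} (hβ : 0 < β) {l : ℂ} (hl : l.re < 1 + β)
    {x : PowerSeries ℂ} (hy : PolyBdd β (fun n => PowerSeries.coeff n (theta x - l • x))) :
    PolyBdd β (fun n => PowerSeries.coeff n x) := by
  obtain ⟨C, hC⟩ := hy
  have hC0 : 0 ≤ C := by
    have := (norm_nonneg _).trans (hC 0)
    simpa using this
  obtain ⟨d, hd⟩ : ∃ d, d = (1 + β - l.re) / 4 := ⟨_, rfl⟩
  have hd0 : 0 < d := by rw [hd]; linarith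
  have ht := tendsto_natCast_atTop_atTop (R := ℝ)
  obtain ⟨N, hN⟩ := Filter.eventually_atTop.1
    ((eventually_norm_add_le (l := l) (a := l.re + 2 * d) (by linarith)).and
      (ht.eventually_ge_atTop (β / d)))
  obtain ⟨K, hK⟩ : ∃ K, K = C / d + ∑ k ∈ Finset.range (N + 1), ‖PowerSeries.coeff k x‖ :=
    ⟨_, rfl⟩
  have hs0 : 0 ≤ ∑ k ∈ Finset.range (N + 1), ‖PowerSeries.coeff k x‖ :=
    Finset.sum_nonneg fun _ _ => norm_nonneg _
  have hKC : C ≤ K * d := by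
    rw [hK, add_mul, div_mul_cancel₀ _ hd0.ne']
    nlinarith
  have hK0 : 0 ≤ K := by rw [hK]; positivity
  have hsmall : ∀ n, n ≤ N → ‖PowerSeries.coeff n x‖ ≤ K * ((n : ℝ) + 1) ^ β := by
    intro n hn
    have h1 : ‖PowerSeries.coeff n x‖ ≤ ∑ k ∈ Finset.range (N + 1), ‖PowerSeries.coeff k x‖ :=
      Finset.single_le_sum (f := fun k => ‖PowerSeries.coeff k x‖)
        (fun _ _ => norm_nonneg _) (Finset.mem_range.2 (by omega))
    have h2 : ‖PowerSeries.coeff n x‖ ≤ K := by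
      rw [hK]; have : 0 ≤ C / d := by positivity
      linarith
    nlinarith [one_le_add_one_rpow hβ.le n]
  refine ⟨K, fun n => ?_⟩
  induction n with
  | zero => exact hsmall 0 (Nat.zero_le _)
  | succ n ih =>
    by_cases hn : n + 1 ≤ N
    · exact hsmall _ hn
    obtain ⟨h1, h2⟩ := hN n (by omega)
    have hc := coeff_theta_sub l x n
    have hn0 : (0 : ℝ) ≤ n := n.cast_nonneg
    have h3 : ((n : ℝ) + 1) * ‖PowerSeries.coeff (n + 1) x‖
        ≤ C * ((n : ℝ) + 1) ^ β + (n + (l.re + 2 * d)) * (K * ((n : ℝ) + 1) ^ β) := by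
      have e : ((n : ℂ) + 1) * PowerSeries.coeff (n + 1) x
          = PowerSeries.coeff n (theta x - l • x) + (n + l) * PowerSeries.coeff n x := by
        rw [hc]; ring
      have e2 : ‖(n : ℂ) + 1‖ = (n : ℝ) + 1 := by exact_mod_cast Complex.norm_natCast (n + 1)
      rw [show ((n : ℝ) + 1) * ‖PowerSeries.coeff (n + 1) x‖
        = ‖((n : ℂ) + 1) * PowerSeries.coeff (n + 1) x‖ by rw [norm_mul, e2], e]
      refine (norm_add_le _ _).trans (add_le_add (hC n) ?_)
      rw [norm_mul]
      exact mul_le_mul h1 ih (norm_nonneg _) ((norm_nonneg _).trans h1)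
    have h4 := succ_rpow_lower hβ.le n
    obtain ⟨p, hp⟩ : ∃ p, p = ((n : ℝ) + 1) ^ β := ⟨_, rfl⟩
    have hp1 : 1 ≤ p := hp ▸ one_le_add_one_rpow hβ.le n
    rw [← hp] at h3 h4
    push_cast
    rw [show (n : ℝ) + 1 + 1 = n + 2 by ring]
    have h5 : β / ((n : ℝ) + 2) ≤ d := by
      rw [div_le_iff₀ (by positivity)]
      rw [div_le_iff₀ hd0] at h2
      nlinarith
    have h6 : ((n : ℝ) + 1) * (1 + β / (n + 2)) = n + 1 + β - β / (n + 2) := by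
      field_simp; ring
    have h7 : ((n : ℝ) + 1) * ‖PowerSeries.coeff (n + 1) x‖
        ≤ ((n : ℝ) + 1) * (K * (p * (1 + β / (n + 2)))) := by
      rw [show ((n : ℝ) + 1) * (K * (p * (1 + β / (n + 2))))
        = K * p * (((n : ℝ) + 1) * (1 + β / (n + 2))) by ring, h6]
      have h8 : C * p ≤ K * d * p := mul_le_mul_of_nonneg_right hKC (by linarith)
      have h9 : 0 ≤ K * p := by positivity
      have h10 : l.re = 1 + β - 4 * d := by rw [hd]; ring
      rw [h10] at h3
      nlinarith
    have h11 := le_of_mul_le_mul_left h7 (by positivity)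
    exact h11.trans (mul_le_mul_of_nonneg_left h4 hK0)

theorem rpow_sub_succ_lower {β : ℝ} (h0 : 0 < β) (h1 : β < 1) (k : ℕ) :
    (1 - β) * (((k : ℝ) + 1) ^ β / ((k + 1) * (k + 2)))
      ≤ ((k : ℝ) + 1) ^ (β - 1) - ((k : ℝ) + 2) ^ (β - 1) := by
  have hk : (0 : ℝ) ≤ k := k.cast_nonneg
  have e1 : ((k : ℝ) + 1) ^ (β - 1) = (k + 1) ^ β / (k + 1) := by
    rw [Real.rpow_sub_one (by positivity)]
  have e2 : ((k : ℝ) + 2) ^ (β - 1) = (k + 2) ^ β / (k + 2) := by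
    rw [Real.rpow_sub_one (by positivity)]
  have h3 : ((k : ℝ) + 2) ^ β ≤ (k + 1) ^ β * (1 + β / (k + 1)) := by
    have := rpow_one_add_le_one_add_mul_self (s := 1 / ((k : ℝ) + 1))
      (by linarith [show (0 : ℝ) ≤ 1 / ((k : ℝ) + 1) by positivity]) h0.le h1.le
    rw [show ((k : ℝ) + 2) = (k + 1) * (1 + 1 / ((k : ℝ) + 1)) by field_simp; ring,
      Real.mul_rpow (by positivity) (by positivity)]
    refine mul_le_mul_of_nonneg_left ?_ (by positivity)
    rw [div_eq_mul_one_div β]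
    exact this
  rw [e1, e2]
  have h4 : ((k : ℝ) + 2) ^ β / (k + 2) ≤ (k + 1) ^ β * (1 + β / (k + 1)) / (k + 2) := by gcongr
  have h5 : (1 - β) * (((k : ℝ) + 1) ^ β / ((k + 1) * (k + 2)))
      = (k + 1) ^ β / (k + 1) - (k + 1) ^ β * (1 + β / (k + 1)) / (k + 2) := by
    field_simp; ring
  linarith

theorem tendsto_add_one_rpow_neg {β : ℝ} (h1 : β < 1) :
    Filter.Tendsto (fun k : ℕ => ((k : ℝ) + 1) ^ (β - 1)) Filter.atTop (nhds 0) := by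
  have := (tendsto_rpow_neg_atTop (y := 1 - β) (by linarith)).comp
    (Filter.tendsto_atTop_add_const_right _ (1 : ℝ) (tendsto_natCast_atTop_atTop (R := ℝ)))
  refine this.congr fun k => ?_
  simp only [Function.comp_apply, neg_sub]

/-- The linear functional `∑ w_k / ((k + 1) (k + 2))`. -/
noncomputable def wsum (w : ℕ → ℂ) : ℂ := ∑' k : ℕ, w k / (((k : ℂ) + 1) * (k + 2))

theorem norm_weight_le {β C : ℝ} {w : ℕ → ℂ} (hC : ∀ n, ‖w n‖ ≤ C * ((n : ℝ) + 1) ^ β) (k : ℕ) :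
    ‖w k / (((k : ℂ) + 1) * (k + 2))‖ ≤ C * (((k : ℝ) + 1) ^ β / ((k + 1) * (k + 2))) := by
  have e2 : ‖(k : ℂ) + 1‖ = (k : ℝ) + 1 := by exact_mod_cast Complex.norm_natCast (k + 1)
  have e3 : ‖(k : ℂ) + 2‖ = (k : ℝ) + 2 := by exact_mod_cast Complex.norm_natCast (k + 2)
  rw [norm_div, norm_mul, e2, e3, mul_div_assoc']
  exact div_le_div_of_nonneg_right (hC k) (by positivity)

theorem summable_rpow_weight {β : ℝ} (h0 : 0 < β) (h1 : β < 1) :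
    Summable (fun k : ℕ => ((k : ℝ) + 1) ^ β / (((k : ℝ) + 1) * (k + 2))) := by
  refine summable_of_sum_range_le (c := 1 / (1 - β)) (fun k => by positivity) fun n => ?_
  have hb : 0 < 1 - β := by linarith
  rw [le_div_iff₀ hb, mul_comm, Finset.mul_sum]
  have : ∀ k : ℕ, (1 - β) * (((k : ℝ) + 1) ^ β / ((k + 1) * (k + 2)))
      ≤ ((k : ℝ) + 1) ^ (β - 1) - (((k + 1 : ℕ) : ℝ) + 1) ^ (β - 1) := by
    intro k
    have := rpow_sub_succ_lower h0 h1 k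
    rw [show (((k + 1 : ℕ) : ℝ) + 1) = k + 2 by push_cast; ring]
    exact this
  refine (Finset.sum_le_sum fun k _ => this k).trans ?_
  rw [Finset.sum_range_sub' (fun k : ℕ => ((k : ℝ) + 1) ^ (β - 1))]
  simp only [Nat.cast_zero, zero_add, Real.one_rpow, tsub_le_iff_right, le_add_iff_nonneg_right]
  positivity

theorem summable_weight {β : ℝ} (h0 : 0 < β) (h1 : β < 1) {w : ℕ → ℂ} (hw : PolyBdd β w) :
    Summable (fun k : ℕ => w k / (((k : ℂ) + 1) * (k + 2))) := by
  obtain ⟨C, hC⟩ := hw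
  exact Summable.of_norm_bounded ((summable_rpow_weight h0 h1).mul_left C) (norm_weight_le hC)

theorem sum_range_weight_theta (x : PowerSeries ℂ) (n : ℕ) :
    ∑ k ∈ Finset.range n, PowerSeries.coeff k (theta x - (2 : ℂ) • x) / (((k : ℂ) + 1) * (k + 2))
      = PowerSeries.coeff n x / ((n : ℂ) + 1) - PowerSeries.coeff 0 x := by
  have := Finset.sum_range_sub (fun k : ℕ => PowerSeries.coeff k x / ((k : ℂ) + 1)) n
  simp only [Nat.cast_zero, zero_add, div_one] at this
  rw [← this]
  refine Finset.sum_congr rfl fun k _ => ?_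
  rw [coeff_theta_sub]
  have a1 : (k : ℂ) + 1 ≠ 0 := by exact_mod_cast (Nat.succ_ne_zero k)
  have a2 : (k : ℂ) + 2 ≠ 0 := by exact_mod_cast (Nat.succ_ne_zero (k + 1))
  have a3 : ((k + 1 : ℕ) : ℂ) + 1 ≠ 0 := by exact_mod_cast (Nat.succ_ne_zero (k + 1))
  rw [show ((k + 1 : ℕ) : ℂ) + 1 = k + 2 by push_cast; ring]
  field_simp

theorem linear_growth {β : ℝ} (h0 : 0 < β) (h1 : β < 1) {x : PowerSeries ℂ}
    (hy : PolyBdd β (fun n => PowerSeries.coeff n (theta x - (2 : ℂ) • x))) :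
    PolyBdd β (fun n => PowerSeries.coeff n x - (PowerSeries.coeff 0 x
      + wsum (fun n => PowerSeries.coeff n (theta x - (2 : ℂ) • x))) * (n + 1)) := by
  have hs := summable_weight h0 h1 hy
  obtain ⟨C, hC⟩ := hy
  have hC0 : 0 ≤ C := by simpa using (norm_nonneg _).trans (hC 0)
  have hb : 0 < 1 - β := by linarith
  set w : ℕ → ℂ := fun n => PowerSeries.coeff n (theta x - (2 : ℂ) • x)
  set L := PowerSeries.coeff 0 x + wsum w with hL
  have hlim : Filter.Tendsto (fun n : ℕ => PowerSeries.coeff n x / ((n : ℂ) + 1))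
      Filter.atTop (nhds L) := by
    have := hs.hasSum.tendsto_sum_nat.const_add (PowerSeries.coeff 0 x)
    refine this.congr fun n => ?_
    rw [sum_range_weight_theta]; ring
  have hstep : ∀ n k : ℕ, ‖PowerSeries.coeff (n + k) x / (((n + k : ℕ) : ℂ) + 1)
      - PowerSeries.coeff n x / ((n : ℂ) + 1)‖
      ≤ C / (1 - β) * (((n : ℝ) + 1) ^ (β - 1) - (((n + k : ℕ) : ℝ) + 1) ^ (β - 1)) := by
    intro n k
    induction k with
    | zero => simp
    | succ k ih =>
      have e1 := sum_range_weight_theta x (n + (k + 1))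
      have e2 := sum_range_weight_theta x (n + k)
      rw [← add_assoc, Finset.sum_range_succ, e2] at e1
      rw [← add_assoc]
      have e3 : PowerSeries.coeff (n + k + 1) x / (((n + k + 1 : ℕ) : ℂ) + 1)
          - PowerSeries.coeff n x / ((n : ℂ) + 1)
          = (PowerSeries.coeff (n + k) x / (((n + k : ℕ) : ℂ) + 1)
            - PowerSeries.coeff n x / ((n : ℂ) + 1))
            + w (n + k) / ((((n + k : ℕ) : ℂ) + 1) * ((n + k : ℕ) + 2)) := by
        linear_combination -e1
      rw [e3]
      refine (norm_add_le _ _).trans ?_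
      have h4 := norm_weight_le hC (n + k)
      have h5 := rpow_sub_succ_lower h0 h1 (n + k)
      rw [show (((n + k + 1 : ℕ) : ℝ) + 1) = ((n + k : ℕ) : ℝ) + 2 by push_cast; ring]
      have h6 : C * ((((n + k : ℕ) : ℝ) + 1) ^ β / ((((n + k : ℕ) : ℝ) + 1) * ((n + k : ℕ) + 2)))
          ≤ C / (1 - β) * ((((n + k : ℕ) : ℝ) + 1) ^ (β - 1)
            - (((n + k : ℕ) : ℝ) + 2) ^ (β - 1)) := by
        rw [div_mul_eq_mul_div, le_div_iff₀ hb]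
        calc _ = C * ((1 - β) * ((((n + k : ℕ) : ℝ) + 1) ^ β
              / ((((n + k : ℕ) : ℝ) + 1) * ((n + k : ℕ) + 2)))) := by ring
          _ ≤ _ := mul_le_mul_of_nonneg_left h5 hC0
      nlinarith
  refine ⟨C / (1 - β), fun n => ?_⟩
  have hbound : ‖L - PowerSeries.coeff n x / ((n : ℂ) + 1)‖
      ≤ C / (1 - β) * ((n : ℝ) + 1) ^ (β - 1) := by
    refine le_of_tendsto ((hlim.sub_const _).norm) ?_
    filter_upwards [Filter.eventually_ge_atTop n] with N hN
    obtain ⟨k, rfl⟩ := Nat.exists_eq_add_of_le hN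
    refine (hstep n k).trans (mul_le_mul_of_nonneg_left ?_ (by positivity))
    have : 0 ≤ (((n + k : ℕ) : ℝ) + 1) ^ (β - 1) := by positivity
    linarith
  have a1 : (n : ℂ) + 1 ≠ 0 := by exact_mod_cast (Nat.succ_ne_zero n)
  have e2 : ‖(n : ℂ) + 1‖ = (n : ℝ) + 1 := by exact_mod_cast Complex.norm_natCast (n + 1)
  have e : PowerSeries.coeff n x - L * (n + 1)
      = -((L - PowerSeries.coeff n x / ((n : ℂ) + 1)) * (n + 1)) := by
    field_simp; ring
  beta_reduce
  rw [e, norm_neg, norm_mul, e2]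
  have e4 : ((n : ℝ) + 1) ^ β = (n + 1) ^ (β - 1) * (n + 1) := by
    rw [← Real.rpow_add_one (by positivity)]; ring_nf
  rw [e4, ← mul_assoc]
  exact mul_le_mul_of_nonneg_right hbound (by positivity)

theorem PolyBdd.add {β : ℝ} {E : Type*} [SeminormedAddCommGroup E] {x y : ℕ → E}
    (hx : PolyBdd β x) (hy : PolyBdd β y) : PolyBdd β (fun n => x n + y n) := by
  obtain ⟨C, hC⟩ := hx
  obtain ⟨D, hD⟩ := hy
  refine ⟨C + D, fun n => ?_⟩
  rw [add_mul]
  exact (norm_add_le _ _).trans (add_le_add (hC n) (hD n))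

theorem PolyBdd.const_mul {β : ℝ} {x : ℕ → ℂ} (hx : PolyBdd β x) (c : ℂ) :
    PolyBdd β (fun n => c * x n) := by
  obtain ⟨C, hC⟩ := hx
  refine ⟨‖c‖ * C, fun n => ?_⟩
  rw [norm_mul, mul_assoc]
  exact mul_le_mul_of_nonneg_left (hC n) (norm_nonneg _)

theorem wsum_theta_sub {β : ℝ} (h0 : 0 < β) (h1 : β < 1) (l : ℂ) {u : PowerSeries ℂ}
    (hu : PolyBdd β (fun n => PowerSeries.coeff n u))
    (hw : PolyBdd β (fun n => PowerSeries.coeff n (theta u - l • u))) :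
    wsum (fun n => PowerSeries.coeff n (theta u - l • u))
      = (2 - l) * wsum (fun n => PowerSeries.coeff n u) - PowerSeries.coeff 0 u := by
  have t1 := (summable_weight h0 h1 hw).hasSum.tendsto_sum_nat
  have t2 := (summable_weight h0 h1 hu).hasSum.tendsto_sum_nat
  have t3 : Filter.Tendsto (fun n : ℕ => PowerSeries.coeff n u / ((n : ℂ) + 1))
      Filter.atTop (nhds 0) := by
    obtain ⟨C, hC⟩ := hu
    refine squeeze_zero_norm (a := fun n : ℕ => C * ((n : ℝ) + 1) ^ (β - 1)) (fun n => ?_) ?_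
    · have e2 : ‖(n : ℂ) + 1‖ = (n : ℝ) + 1 := by exact_mod_cast Complex.norm_natCast (n + 1)
      rw [norm_div, e2, Real.rpow_sub_one (by positivity), mul_div_assoc']
      exact div_le_div_of_nonneg_right (hC n) (by positivity)
    · simpa using (tendsto_add_one_rpow_neg h1).const_mul C
  have t4 := (t3.sub_const (PowerSeries.coeff 0 u)).add (t2.const_mul (2 - l))
  refine (tendsto_nhds_unique t1 (t4.congr fun n => ?_)).trans (by rw [wsum]; ring)
  rw [← sum_range_weight_theta, Finset.mul_sum, ← Finset.sum_add_distrib]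
  refine Finset.sum_congr rfl fun k _ => ?_
  simp only [map_sub, map_smul, smul_eq_mul]
  ring

open Polynomial in
theorem aeval_theta_X_sub_C (l : ℂ) (x : PowerSeries ℂ) :
    (aeval theta (X - C l) : Module.End ℂ (PowerSeries ℂ)) x = theta x - l • x := by
  simp [Module.algebraMap_end_apply]

theorem coeff_theta_sub_eq_zero {k : ℕ} {x : PowerSeries ℂ} (l : ℂ)
    (hx : ∀ n < k + 1, PowerSeries.coeff n x = 0) :
    ∀ n < k, PowerSeries.coeff n (theta x - l • x) = 0 := by
  intro n hn
  rw [coeff_theta_sub, hx _ (by omega), hx _ (by omega)]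
  ring

open Polynomial in
theorem coeff_aeval_theta_eq_zero (s : Multiset ℂ) {k : ℕ} {x : PowerSeries ℂ}
    (hx : ∀ n < s.card + k, PowerSeries.coeff n x = 0) :
    ∀ n < k, PowerSeries.coeff n
      ((aeval theta (s.map (fun a => X - C a)).prod : Module.End ℂ (PowerSeries ℂ)) x) = 0 := by
  induction s using Multiset.induction_on generalizing k with
  | empty => simpa using hx
  | cons a s ih =>
    rw [Multiset.map_cons, Multiset.prod_cons, map_mul, Module.End.mul_apply,
      aeval_theta_X_sub_C]
    refine coeff_theta_sub_eq_zero a (ih fun n hn => hx n ?_)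
    rw [Multiset.card_cons]
    omega

open Polynomial in
theorem polyBdd_of_aeval_theta {β : ℝ} (h0 : 0 < β) (s : Multiset ℂ)
    (hs : ∀ a ∈ s, a.re < 1 + β) {x : PowerSeries ℂ}
    (hx : PolyBdd β (fun n => PowerSeries.coeff n
      ((aeval theta (s.map (fun a => X - C a)).prod : Module.End ℂ (PowerSeries ℂ)) x))) :
    PolyBdd β (fun n => PowerSeries.coeff n x) := by
  induction s using Multiset.induction_on with
  | empty => simpa using hx
  | cons a s ih =>
    rw [Multiset.map_cons, Multiset.prod_cons, map_mul] at hx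
    simp only [Module.End.mul_apply, aeval_theta_X_sub_C] at hx
    exact ih (fun b hb => hs b (Multiset.mem_cons_of_mem hb))
      (polyBdd_of_theta_sub h0 (hs a (Multiset.mem_cons_self a s)) hx)

open Polynomial in
theorem wsum_aeval_theta {β : ℝ} (h0 : 0 < β) (h1 : β < 1) (s : Multiset ℂ)
    (hs : ∀ a ∈ s, a.re < 1 + β) {x : PowerSeries ℂ}
    (hx : PolyBdd β (fun n => PowerSeries.coeff n
      ((aeval theta (s.map (fun a => X - C a)).prod : Module.End ℂ (PowerSeries ℂ)) x)))
    (hx0 : ∀ n < s.card, PowerSeries.coeff n x = 0) :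
    wsum (fun n => PowerSeries.coeff n
      ((aeval theta (s.map (fun a => X - C a)).prod : Module.End ℂ (PowerSeries ℂ)) x))
      = eval 2 (s.map (fun a => X - C a)).prod * wsum (fun n => PowerSeries.coeff n x) := by
  induction s using Multiset.induction_on with
  | empty => simp
  | cons a s ih =>
    have hs' : ∀ b ∈ s, b.re < 1 + β := fun b hb => hs b (Multiset.mem_cons_of_mem hb)
    rw [Multiset.map_cons, Multiset.prod_cons, map_mul] at hx ⊢
    simp only [Module.End.mul_apply, aeval_theta_X_sub_C] at hx ⊢
    have hu := polyBdd_of_theta_sub h0 (hs a (Multiset.mem_cons_self a s)) hx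
    rw [wsum_theta_sub h0 h1 a hu hx, ih hs' hu fun n hn => hx0 n (by
      rw [Multiset.card_cons]; omega)]
    rw [coeff_aeval_theta_eq_zero s (k := 1) (fun n hn => hx0 n (by
      rw [Multiset.card_cons]; omega)) 0 one_pos]
    simp
    ring

theorem arg_eq_arctan {z : ℂ} (hz : 0 < z.re) : z.arg = Real.arctan (z.im / z.re) := by
  have h := abs_lt.1 ((Complex.abs_arg_lt_pi_div_two_iff).2 (Or.inl hz))
  rw [← Complex.tan_arg, Real.arctan_tan h.1 h.2]

theorem prod_eq_norm_mul_exp {ι : Type*} (s : Finset ι) (f : ι → ℂ) :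
    ∏ j ∈ s, f j = ((∏ j ∈ s, ‖f j‖ : ℝ) : ℂ)
      * Complex.exp (((∑ j ∈ s, (f j).arg : ℝ) : ℂ) * Complex.I) := by
  push_cast
  rw [Finset.sum_mul, Complex.exp_sum, ← Finset.prod_mul_distrib]
  exact Finset.prod_congr rfl fun j _ => (Complex.norm_mul_exp_arg_mul_I (f j)).symm

/-- Real and imaginary parts of the partial products of `375 + 250 j + 551 i`. -/
def gaussProd : ℕ → ℤ × ℤ
  | 0 => (1, 0)
  | k + 1 => ((gaussProd k).1 * (375 + 250 * k) - (gaussProd k).2 * 551,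
      (gaussProd k).1 * 551 + (gaussProd k).2 * (375 + 250 * k))

/-- The complex number `375 + 250 j + 551 i`. -/
noncomputable def gaussFactor (j : ℕ) : ℂ := ⟨375 + 250 * j, 551⟩

theorem prod_gaussFactor (k : ℕ) :
    ∏ j ∈ Finset.range k, gaussFactor j = ⟨(gaussProd k).1, (gaussProd k).2⟩ := by
  induction k with
  | zero => apply Complex.ext <;> simp [gaussProd]
  | succ k ih =>
    rw [Finset.prod_range_succ, ih, gaussFactor]
    apply Complex.ext <;> simp [gaussProd]

theorem gaussFactor_arg_pos (j : ℕ) : 0 < (gaussFactor j).arg := by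
  rw [arg_eq_arctan (by simp only [gaussFactor]; positivity)]
  apply Real.arctan_pos.2
  simp only [gaussFactor]
  positivity

theorem gaussFactor_arg_lt (j : ℕ) : (gaussFactor j).arg < Real.pi / 2 := by
  rw [arg_eq_arctan (by simp only [gaussFactor]; positivity)]
  exact Real.arctan_lt_pi_div_two _

theorem gaussProd_im_eq (k : ℕ) : ∃ R : ℝ, 0 < R ∧
    ((gaussProd k).2 : ℝ) = R * Real.sin (∑ j ∈ Finset.range k, (gaussFactor j).arg) := by
  refine ⟨∏ j ∈ Finset.range k, ‖gaussFactor j‖, Finset.prod_pos fun j _ => ?_, ?_⟩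
  · rw [norm_pos_iff]
    intro h
    have := congrArg Complex.im h
    norm_num [gaussFactor] at this
  · have h := prod_eq_norm_mul_exp (Finset.range k) gaussFactor
    rw [prod_gaussFactor] at h
    have h2 := congrArg Complex.im h
    rw [Complex.im_ofReal_mul, Complex.exp_ofReal_mul_I_im] at h2
    exact h2

theorem gaussProd_im_pos : ∀ k < 5, 0 < (gaussProd (k + 1)).2 := by decide +kernel

theorem gaussProd_im_neg : ∀ k < 20, (gaussProd (k + 6)).2 < 0 := by decide +kernel

theorem sum_gaussFactor_arg_lt_pi : ∀ k ≤ 5,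
    ∑ j ∈ Finset.range k, (gaussFactor j).arg < Real.pi := by
  intro k
  induction k with
  | zero => intro _; simpa using Real.pi_pos
  | succ k ih =>
    intro hk
    have ih := ih (by omega)
    obtain ⟨R, hR, h⟩ := gaussProd_im_eq (k + 1)
    have hp : (0 : ℝ) < (gaussProd (k + 1)).2 := by exact_mod_cast gaussProd_im_pos k (by omega)
    by_contra! hcon
    have h2 : ∑ j ∈ Finset.range (k + 1), (gaussFactor j).arg ≤ Real.pi + Real.pi := by
      rw [Finset.sum_range_succ]
      linarith [gaussFactor_arg_lt k, Real.pi_pos]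
    have h3 : Real.sin (∑ j ∈ Finset.range (k + 1), (gaussFactor j).arg) ≤ 0 := by
      have := Real.sin_nonneg_of_nonneg_of_le_pi
        (x := ∑ j ∈ Finset.range (k + 1), (gaussFactor j).arg - Real.pi) (by linarith)
        (by linarith)
      rw [Real.sin_sub_pi] at this
      linarith
    nlinarith

theorem sum_gaussFactor_arg_mem : ∀ k < 20,
    Real.pi < ∑ j ∈ Finset.range (k + 6), (gaussFactor j).arg ∧
      ∑ j ∈ Finset.range (k + 6), (gaussFactor j).arg < 2 * Real.pi := by
  intro k
  induction k with
  | zero =>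
    intro _
    have h5 := sum_gaussFactor_arg_lt_pi 5 le_rfl
    have h6 : ∑ j ∈ Finset.range (0 + 6), (gaussFactor j).arg
        = ∑ j ∈ Finset.range 5, (gaussFactor j).arg + (gaussFactor 5).arg :=
      Finset.sum_range_succ _ 5
    have hlt := gaussFactor_arg_lt 5
    refine ⟨?_, by rw [h6]; linarith [Real.pi_pos]⟩
    obtain ⟨R, hR, h⟩ := gaussProd_im_eq (0 + 6)
    have hp : ((gaussProd (0 + 6)).2 : ℝ) < 0 := by
      exact_mod_cast gaussProd_im_neg 0 (by omega)
    by_contra! hcon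
    have h3 := Real.sin_nonneg_of_nonneg_of_le_pi
      (Finset.sum_nonneg fun j (_ : j ∈ Finset.range (0 + 6)) => (gaussFactor_arg_pos j).le) hcon
    nlinarith
  | succ k ih =>
    intro hk
    have ih := ih (by omega)
    have h6 : ∑ j ∈ Finset.range (k + 1 + 6), (gaussFactor j).arg
        = ∑ j ∈ Finset.range (k + 6), (gaussFactor j).arg + (gaussFactor (k + 6)).arg := by
      rw [show k + 1 + 6 = k + 6 + 1 by ring, Finset.sum_range_succ]
    have hlt := gaussFactor_arg_lt (k + 6)
    have hpos := gaussFactor_arg_pos (k + 6)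
    refine ⟨by rw [h6]; linarith, ?_⟩
    obtain ⟨R, hR, h⟩ := gaussProd_im_eq (k + 1 + 6)
    have hp : ((gaussProd (k + 1 + 6)).2 : ℝ) < 0 := by
      exact_mod_cast gaussProd_im_neg (k + 1) hk
    by_contra! hcon
    have h3 : 0 ≤ Real.sin (∑ j ∈ Finset.range (k + 1 + 6), (gaussFactor j).arg) := by
      rw [← Real.sin_sub_two_pi]
      exact Real.sin_nonneg_of_nonneg_of_le_pi (by linarith) (by rw [h6]; linarith)
    nlinarith

theorem sum_gaussFactor_arg_lt {k : ℕ} (hk : k ≤ 25) :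
    ∑ j ∈ Finset.range k, (gaussFactor j).arg < 2 * Real.pi := by
  refine lt_of_le_of_lt ?_ (sum_gaussFactor_arg_mem 19 (by omega)).2
  exact Finset.sum_le_sum_of_subset_of_nonneg (Finset.range_subset_range.2 (by omega))
    fun j _ _ => (gaussFactor_arg_pos j).le

/-- Partial products of the squared moduli of `375 + 250 j + 551 i`. -/
def modProd : ℕ → ℕ
  | 0 => 1
  | k + 1 => modProd k * ((375 + 250 * k) ^ 2 + 551 ^ 2)

theorem modProd_eq (k : ℕ) :
    (modProd k : ℝ) = ∏ j ∈ Finset.range k, ((375 + 250 * (j : ℝ)) ^ 2 + 551 ^ 2) := by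
  induction k with
  | zero => simp [modProd]
  | succ k ih => rw [Finset.prod_range_succ, ← ih, modProd]; push_cast; ring

theorem modProd_gt : ∀ k < 25,
    (Nat.factorial (k + 2)) ^ 2 * 250 ^ (2 * (k + 1)) < modProd (k + 1) := by decide +kernel

theorem root_re_lt_of_im_pos {k : ℕ} (hk0 : 1 ≤ k) (hk : k ≤ 25) {z : ℂ}
    (hz : ∏ j ∈ Finset.range k, (z + j) = (k + 1).factorial) (hy : 0 < z.im) :
    z.re < 3 / 2 := by
  by_contra! hre
  have hpos : ∀ j : ℕ, 0 < (z + j).re := fun j => by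
    simp only [Complex.add_re, Complex.natCast_re]; positivity
  by_cases hY : 551 / 250 ≤ z.im
  · have h1 : ∏ j ∈ Finset.range k, Complex.normSq (z + j) = ((k + 1).factorial : ℝ) ^ 2 := by
      rw [← map_prod, hz, Complex.normSq_natCast, sq]
    have h2 : ∏ j ∈ Finset.range k, (((375 + 250 * (j : ℝ)) ^ 2 + 551 ^ 2) / 250 ^ 2)
        ≤ ∏ j ∈ Finset.range k, Complex.normSq (z + j) := by
      refine Finset.prod_le_prod (fun j _ => by positivity) fun j _ => ?_
      rw [Complex.normSq_apply]
      simp only [Complex.add_re, Complex.natCast_re, Complex.add_im, Complex.natCast_im, add_zero]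
      have hj : (0 : ℝ) ≤ j := j.cast_nonneg
      nlinarith
    rw [Finset.prod_div_distrib, ← modProd_eq, h1, Finset.prod_const, Finset.card_range,
      ← pow_mul, div_le_iff₀ (by positivity)] at h2
    obtain ⟨i, rfl⟩ := Nat.exists_eq_add_of_le' hk0
    have h3 := modProd_gt i (by omega)
    have h4 : modProd (i + 1) ≤ (Nat.factorial (i + 2)) ^ 2 * 250 ^ (2 * (i + 1)) := by
      exact_mod_cast h2
    omega
  · have hexp := prod_eq_norm_mul_exp (Finset.range k) (fun j : ℕ => z + j)
    have hnorm : ∏ j ∈ Finset.range k, ‖z + (j : ℂ)‖ = ((k + 1).factorial : ℝ) := by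
      rw [← norm_prod, hz, Complex.norm_natCast]
    rw [hz, hnorm] at hexp
    have hf : ((k + 1).factorial : ℝ) ≠ 0 := by exact_mod_cast (Nat.factorial_ne_zero _)
    have hcos : Real.cos (∑ j ∈ Finset.range k, (z + j).arg) = 1 := by
      have h2 := congrArg Complex.re hexp
      rw [Complex.re_ofReal_mul, Complex.exp_ofReal_mul_I_re, Complex.natCast_re] at h2
      exact (mul_left_cancel₀ hf (by rw [mul_one]; exact h2)).symm
    have hargpos : ∀ j : ℕ, 0 < (z + j).arg := fun j => by
      rw [arg_eq_arctan (hpos j)]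
      exact Real.arctan_pos.2 (div_pos (by simpa using hy) (hpos j))
    have hS0 : 0 < ∑ j ∈ Finset.range k, (z + j).arg :=
      Finset.sum_pos (fun j _ => hargpos j) ⟨0, Finset.mem_range.2 hk0⟩
    have hle : ∑ j ∈ Finset.range k, (z + j).arg ≤ ∑ j ∈ Finset.range k, (gaussFactor j).arg := by
      refine Finset.sum_le_sum fun j _ => ?_
      rw [arg_eq_arctan (hpos j), arg_eq_arctan (by simp only [gaussFactor]; positivity)]
      refine Real.arctan_mono ?_
      have hp := hpos j
      simp only [Complex.add_re, Complex.natCast_re, Complex.add_im, Complex.natCast_im, add_zero,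
        gaussFactor] at hp ⊢
      have hj : (0 : ℝ) ≤ j := j.cast_nonneg
      rw [div_le_div_iff₀ hp (by positivity)]
      nlinarith
    have hlt := hle.trans_lt (sum_gaussFactor_arg_lt hk)
    exact hS0.ne' ((Real.cos_eq_one_iff_of_lt_of_lt (by linarith) hlt).1 hcos)

theorem root_re_lt {k : ℕ} (hk0 : 1 ≤ k) (hk : k ≤ 25) {z : ℂ}
    (hz : ∏ j ∈ Finset.range k, (z + j) = (k + 1).factorial) (h2 : z ≠ 2) :
    z.re < 3 / 2 := by
  rcases lt_trichotomy z.im 0 with hy | hy | hy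
  · have := root_re_lt_of_im_pos hk0 hk (z := (starRingEnd ℂ) z) (by
      have := congrArg (starRingEnd ℂ) hz
      simpa [map_prod] using this) (by simpa using hy)
    simpa using this
  · by_contra! hre
    have hzr : z = (z.re : ℂ) := Complex.ext rfl (by simpa using hy)
    rw [hzr] at hz
    have hr : ∏ j ∈ Finset.range k, (z.re + j) = ((k + 1).factorial : ℝ) := by exact_mod_cast hz
    have hr2 : ∏ j ∈ Finset.range k, ((2 : ℝ) + j) = ((k + 1).factorial : ℝ) := by
      clear hz hr hk hk0
      induction k with
      | zero => simp
      | succ k ih =>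
        rw [Finset.prod_range_succ, ih, Nat.factorial_succ (k + 1)]; push_cast; ring
    have hne : z.re ≠ 2 := fun h => h2 (by rw [hzr, h]; norm_num)
    have hmem : (Finset.range k).Nonempty := ⟨0, Finset.mem_range.2 hk0⟩
    have hj : ∀ j : ℕ, (0 : ℝ) ≤ j := fun j => j.cast_nonneg
    rcases lt_or_gt_of_ne hne with h | h
    · have := Finset.prod_lt_prod_of_nonempty (s := Finset.range k)
        (f := fun j : ℕ => z.re + j) (g := fun j : ℕ => (2 : ℝ) + j)
        (fun j _ => by have := hj j; linarith) (fun j _ => by simpa using h) hmem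
      simp only [hr, hr2, lt_irrefl] at this
    · have := Finset.prod_lt_prod_of_nonempty (s := Finset.range k)
        (f := fun j : ℕ => (2 : ℝ) + j) (g := fun j : ℕ => z.re + j)
        (fun j _ => by have := hj j; linarith) (fun j _ => by simpa using h) hmem
      simp only [hr, hr2, lt_irrefl] at this
  · exact root_re_lt_of_im_pos hk0 hk hz hy

open Polynomial in
/-- The rising factorial as a polynomial. -/
noncomputable def risePoly (k : ℕ) : ℂ[X] := ∏ j ∈ Finset.range k, (X + C (j : ℂ))

open Polynomial in
theorem risePoly_monic (k : ℕ) : (risePoly k).Monic :=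
  monic_prod_of_monic _ _ fun _ _ => monic_X_add_C _

open Polynomial in
theorem risePoly_natDegree (k : ℕ) : (risePoly k).natDegree = k := by
  rw [risePoly, natDegree_prod_of_monic _ _ fun _ _ => monic_X_add_C _]
  simp only [natDegree_X_add_C, Finset.sum_const, Finset.card_range, smul_eq_mul, mul_one]

open Polynomial in
theorem eval_risePoly (k : ℕ) (z : ℂ) :
    eval z (risePoly k) = ∏ j ∈ Finset.range k, (z + j) := by
  simp [risePoly, eval_prod]

theorem prod_two_add (k : ℕ) : ∏ j ∈ Finset.range k, ((2 : ℂ) + j) = (k + 1).factorial := by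
  induction k with
  | zero => simp
  | succ k ih => rw [Finset.prod_range_succ, ih, Nat.factorial_succ (k + 1)]; push_cast; ring

open Polynomial in
theorem eval_derivative_risePoly (k : ℕ) :
    eval 2 (derivative (risePoly k)) = (((k + 1).factorial * (Hm (k + 1) - 1) : ℝ) : ℂ) := by
  induction k with
  | zero => simp [risePoly, Hm]
  | succ k ih =>
    have h1 : risePoly (k + 1) = risePoly k * (X + C (k : ℂ)) := Finset.prod_range_succ _ _
    have h2 : Hm (k + 1 + 1) = Hm (k + 1) + 1 / (k + 2) := by
      rw [Hm, Finset.sum_range_succ, Hm]; push_cast; ring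
    have hk : (k : ℂ) + 2 ≠ 0 := by exact_mod_cast Nat.succ_ne_zero (k + 1)
    rw [h1, derivative_mul, eval_add, eval_mul, eval_mul, ih, eval_risePoly, prod_two_add, h2,
      Nat.factorial_succ (k + 1)]
    simp
    field_simp
    ring

theorem one_lt_Hm {m : ℕ} (hm : 2 ≤ m) : 1 < Hm m := by
  have h : Hm 2 ≤ Hm m := Finset.sum_le_sum_of_subset_of_nonneg
    (Finset.range_subset_range.2 hm) fun i _ _ => by positivity
  have h2 : Hm 2 = 3 / 2 := by norm_num [Hm, Finset.sum_range_succ]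
  linarith

open Polynomial in
theorem exists_factorization {m : ℕ} (hm : 2 ≤ m) (hm' : m ≤ 26) :
    ∃ s : Multiset ℂ, s.card = m - 2 ∧ (∀ a ∈ s, a.re < 3 / 2) ∧
      risePoly (m - 1) - C (m.factorial : ℂ)
        = (s.map (fun a => X - C a)).prod * (X - C 2) ∧
      (s.map (fun a => X - C a)).prod.eval 2 = ((m.factorial * (Hm m - 1) : ℝ) : ℂ) := by
  obtain ⟨k, rfl⟩ := Nat.exists_eq_add_of_le' (show 1 ≤ m by omega)
  rw [Nat.add_sub_cancel]
  set P : ℂ[X] := risePoly k - C ((k + 1).factorial : ℂ) with hP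
  have hdeg : (C ((k + 1).factorial : ℂ)).degree < (risePoly k).degree := by
    refine degree_C_le.trans_lt ?_
    rw [degree_eq_natDegree (risePoly_monic k).ne_zero, risePoly_natDegree]
    exact_mod_cast (by omega : 0 < k)
  have hmonic : P.Monic := (risePoly_monic k).sub_of_left hdeg
  have hnat : P.natDegree = k := by
    rw [hP, natDegree_sub_C, risePoly_natDegree]
  have hroot : (2 : ℂ) ∈ P.roots := by
    rw [mem_roots hmonic.ne_zero, IsRoot, hP, eval_sub, eval_C, eval_risePoly, prod_two_add,
      sub_self]
  have hsplit := IsAlgClosed.splits P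
  have hprod : P = (P.roots.map (fun a => X - C a)).prod := by
    have := hsplit.eq_prod_roots
    rwa [hmonic.leadingCoeff, C_1, one_mul] at this
  obtain ⟨s, hs⟩ := Multiset.exists_cons_of_mem hroot
  have hfac : P = (s.map (fun a => X - C a)).prod * (X - C 2) := by
    rw [hs, Multiset.map_cons, Multiset.prod_cons, mul_comm] at hprod
    exact hprod
  have hQ : eval 2 (s.map (fun a => X - C a)).prod
      = (((k + 1).factorial * (Hm (k + 1) - 1) : ℝ) : ℂ) := by
    rw [← eval_derivative_risePoly]
    have h1 := congrArg (fun p => eval 2 (derivative p)) hfac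
    simp only [hP, derivative_mul, derivative_sub, derivative_C, derivative_X, sub_zero, mul_one,
      eval_add, eval_mul, eval_sub, eval_X, eval_C, sub_self, mul_zero, zero_add] at h1
    exact h1.symm
  have hQ0 : eval 2 (s.map (fun a => X - C a)).prod ≠ 0 := by
    rw [hQ]
    have := one_lt_Hm hm
    have h2 : (0 : ℝ) < (k + 1).factorial := by exact_mod_cast Nat.factorial_pos _
    exact_mod_cast (mul_pos h2 (by linarith)).ne'
  refine ⟨s, ?_, fun a ha => ?_, hfac, hQ⟩
  · have h1 := hsplit.natDegree_eq_card_roots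
    rw [hnat, hs, Multiset.card_cons] at h1
    omega
  · have hmem : a ∈ P.roots := by rw [hs]; exact Multiset.mem_cons_of_mem ha
    rw [mem_roots hmonic.ne_zero, IsRoot, hP, eval_sub, eval_C, eval_risePoly, sub_eq_zero] at hmem
    refine root_re_lt (by omega) (by omega) hmem ?_
    rintro rfl
    refine hQ0 ?_
    rw [eval_multiset_prod, Multiset.prod_eq_zero_iff]
    simp only [Multiset.map_map, Multiset.mem_map]
    exact ⟨2, ha, by simp⟩

theorem coeff_prod_fin {R : Type*} [CommRing R] {m : ℕ} (f : Fin m → PowerSeries R) (N : ℕ) :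
    PowerSeries.coeff N (∏ i, f i)
      = ∑ I ∈ Finset.piAntidiag (Finset.univ : Finset (Fin m)) N,
        ∏ i, PowerSeries.coeff (I i) (f i) := by
  rw [PowerSeries.coeff_prod]
  refine Finset.sum_bij (fun l _ => (l : Fin m → ℕ)) (fun l hl => ?_) (fun l _ l' _ h => ?_)
    (fun I hI => ?_) (fun l _ => rfl)
  · rw [Finset.mem_finsuppAntidiag] at hl
    exact Finset.mem_piAntidiag.2 ⟨hl.1, fun i _ => Finset.mem_univ i⟩
  · exact DFunLike.coe_injective h
  · refine ⟨Finsupp.equivFunOnFinite.symm I, ?_, by simp⟩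
    rw [Finset.mem_finsuppAntidiag]
    exact ⟨by simpa using (Finset.mem_piAntidiag.1 hI).1, Finset.subset_univ _⟩

/-- Generating function of the sums of a sequence over compositions. -/
theorem sum_piAntidiag_sum {R : Type*} [CommRing R] (m N : ℕ) (x : ℕ → R) :
    ∑ I ∈ Finset.piAntidiag (Finset.univ : Finset (Fin m)) N, ∑ j, x (I j)
      = m * PowerSeries.coeff N (PowerSeries.mk x * PowerSeries.mk 1 ^ (m - 1)) := by
  rw [Finset.sum_comm]
  have h : ∀ j : Fin m, ∑ I ∈ Finset.piAntidiag (Finset.univ : Finset (Fin m)) N, x (I j)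
      = PowerSeries.coeff N (PowerSeries.mk x * PowerSeries.mk 1 ^ (m - 1)) := by
    intro j
    have e : PowerSeries.mk x * PowerSeries.mk 1 ^ (m - 1)
        = ∏ i : Fin m, if i = j then PowerSeries.mk x else PowerSeries.mk 1 := by
      rw [← Finset.mul_prod_erase _ _ (Finset.mem_univ j), if_pos rfl,
        Finset.prod_congr rfl fun i hi => if_neg (Finset.ne_of_mem_erase hi), Finset.prod_const,
        Finset.card_erase_of_mem (Finset.mem_univ j), Finset.card_univ, Fintype.card_fin]
    rw [e, coeff_prod_fin]
    refine Finset.sum_congr rfl fun I _ => ?_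
    rw [Finset.prod_eq_single j]
    · simp
    · intro i _ hi
      simp [hi]
    · simp
  rw [Finset.sum_congr rfl fun j _ => h j]
  simp

open Polynomial in
theorem aeval_theta_risePoly (k : ℕ) (x : PowerSeries ℂ) :
    (aeval theta (risePoly k) : Module.End ℂ (PowerSeries ℂ)) x
      = (1 - PowerSeries.X) ^ k * (PowerSeries.derivative ℂ)^[k] x := by
  induction k with
  | zero => simp [risePoly]
  | succ k ih =>
    have h1 : risePoly (k + 1) = (X + C (k : ℂ)) * risePoly k := by
      rw [mul_comm]; exact Finset.prod_range_succ _ _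
    rw [h1, map_mul, Module.End.mul_apply, ih]
    simp only [map_add, aeval_X, aeval_C, LinearMap.add_apply, Module.algebraMap_end_apply,
      theta_apply, Derivation.leibniz, smul_eq_mul, Function.iterate_succ_apply']
    rw [PowerSeries.derivative_pow]
    simp only [map_sub, PowerSeries.derivative_one, PowerSeries.derivative_X]
    rw [PowerSeries.smul_eq_C_mul]
    rcases k with _ | k
    · simp
    · simp only [map_natCast, Nat.add_sub_cancel]
      ring

theorem aeval_theta_of_recurrence {m : ℕ} (hm : 2 ≤ m) {x b : ℕ → ℝ}
    (hrec : ∀ n, m - 1 ≤ n → x n = compAvg m n (fun I => ∑ i, x (I i)) + b n) :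
    (Polynomial.aeval theta (risePoly (m - 1)) : Module.End ℂ (PowerSeries ℂ))
        (PowerSeries.mk fun n => ((x n - b n : ℝ) : ℂ))
      = (m.factorial : ℂ) • PowerSeries.mk (fun n => ((x n : ℝ) : ℂ)) := by
  rw [aeval_theta_risePoly]
  have h1 : (PowerSeries.derivative ℂ)^[m - 1] (PowerSeries.mk fun n => ((x n - b n : ℝ) : ℂ))
      = (m.factorial : ℂ) • (PowerSeries.mk (fun n => ((x n : ℝ) : ℂ))
        * PowerSeries.mk 1 ^ (m - 1)) := by
    ext N
    rw [PowerSeries.coeff_iterate_derivative, PowerSeries.coeff_mk, map_smul, smul_eq_mul]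
    have h2 : x (N + (m - 1)) - b (N + (m - 1))
        = compAvg m (N + (m - 1)) (fun I => ∑ i, x (I i)) := by
      rw [hrec _ (by omega)]; ring
    rw [h2, ← compAvg_ofReal, compAvg, Nat.add_sub_cancel]
    push_cast
    rw [sum_piAntidiag_sum m N (fun n => ((x n : ℝ) : ℂ)), Complex.real_smul]
    have h3 : ((N + 1).ascFactorial (m - 1) : ℂ)
        = (m - 1).factorial * ((N + (m - 1)).choose (m - 1) : ℂ) := by
      exact_mod_cast Nat.ascFactorial_eq_factorial_mul_choose N (m - 1)
    have h4 : (m.factorial : ℂ) = m * (m - 1).factorial := by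
      exact_mod_cast (Nat.mul_factorial_pred (by omega)).symm
    have h5 : ((N + (m - 1)).choose (m - 1) : ℂ) ≠ 0 := by
      exact_mod_cast (Nat.choose_pos (by omega)).ne'
    rw [h3, h4]
    push_cast
    field_simp
  rw [h1, mul_smul_comm, mul_comm, mul_assoc, ← mul_pow, PowerSeries.mk_one_mul_one_sub_eq_one,
    one_pow, mul_one]

/-- The sequence `b` is the toll of a recurrence satisfied by `x`. -/
structure IsRecurrence (m : ℕ) (x b : ℕ → ℝ) : Prop where
  x_of_lt : ∀ n < m - 1, x n = 0
  b_of_lt : ∀ n < m - 1, b n = 0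
  rec_eq : ∀ n, m - 1 ≤ n → x n = compAvg m n (fun I => ∑ i, x (I i)) + b n

/-- The growth rate of the solution of a recurrence with toll `b`. -/
noncomputable def growthRate (m : ℕ) (b : ℕ → ℝ) : ℝ :=
  (∑' n : ℕ, b n / (((n : ℝ) + 1) * (n + 2))) / (Hm m - 1)

/-- The exponent `β` controls the error terms of all the recurrences. -/
def IsErrorExponent (m : ℕ) (β : ℝ) : Prop :=
  ∀ x b : ℕ → ℝ, IsRecurrence m x b → PolyBdd β b →
    PolyBdd β (fun n => x n - growthRate m b * (n + 1))

theorem wsum_ofReal (b : ℕ → ℝ) :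
    wsum (fun n => ((b n : ℝ) : ℂ)) = ((∑' n : ℕ, b n / (((n : ℝ) + 1) * (n + 2)) : ℝ) : ℂ) := by
  rw [wsum, Complex.ofReal_tsum]
  push_cast
  rfl

open Polynomial in
theorem exists_isErrorExponent {m : ℕ} (hm : 2 ≤ m) (hm' : m ≤ 26) :
    ∃ β₀ : ℝ, 0 < β₀ ∧ β₀ < 1 / 2 ∧ ∀ β, β₀ ≤ β → β < 1 → IsErrorExponent m β := by
  obtain ⟨s, hcard, hre, hfac, hQ⟩ := exists_factorization hm hm'
  obtain ⟨β₀, h0, hhalf, hβ₀⟩ : ∃ β₀ : ℝ, 0 < β₀ ∧ β₀ < 1 / 2 ∧ ∀ a ∈ s, a.re < 1 + β₀ := by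
    clear hcard hfac hQ
    induction s using Multiset.induction_on with
    | empty => exact ⟨1 / 4, by norm_num, by norm_num, by simp⟩
    | cons a s ih =>
      obtain ⟨b, hb0, hb1, hb⟩ := ih fun c hc => hre c (Multiset.mem_cons_of_mem hc)
      have ha := hre a (Multiset.mem_cons_self a s)
      refine ⟨max b ((a.re - 1 + 1 / 2) / 2), lt_max_of_lt_left hb0,
        max_lt hb1 (by linarith), fun c hc => ?_⟩
      rcases Multiset.mem_cons.1 hc with rfl | hc
      · have := le_max_right b ((c.re - 1 + 1 / 2) / 2); linarith
      · have := le_max_left b ((a.re - 1 + 1 / 2) / 2); linarith [hb c hc]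
  refine ⟨β₀, h0, hhalf, fun β hβ hβ1 x b hxb hb => ?_⟩
  have hβ0 : 0 < β := h0.trans_le hβ
  have hs : ∀ a ∈ s, a.re < 1 + β := fun a ha => (hβ₀ a ha).trans_le (by linarith)
  obtain ⟨Y, hY⟩ : ∃ Y : PowerSeries ℂ, Y = PowerSeries.mk fun n => ((x n - b n : ℝ) : ℂ) :=
    ⟨_, rfl⟩
  have hYc : ∀ n, PowerSeries.coeff n Y = ((x n - b n : ℝ) : ℂ) := fun n => by
    rw [hY, PowerSeries.coeff_mk]
  have hY0 : ∀ n < m - 1, PowerSeries.coeff n Y = 0 := fun n hn => by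
    rw [hYc, hxb.x_of_lt n hn, hxb.b_of_lt n hn]; simp
  obtain ⟨w, hw⟩ : ∃ w, w = theta Y - (2 : ℂ) • Y := ⟨_, rfl⟩
  have hw0 : ∀ n < s.card, PowerSeries.coeff n w = 0 := by
    rw [hw]
    exact coeff_theta_sub_eq_zero 2 fun n hn => hY0 n (by omega)
  have hQw : (aeval theta (s.map (fun a => X - C a)).prod : Module.End ℂ (PowerSeries ℂ)) w
      = (m.factorial : ℂ) • PowerSeries.mk (fun n => ((b n : ℝ) : ℂ)) := by
    rw [hw, ← aeval_theta_X_sub_C, ← Module.End.mul_apply, ← map_mul, ← hfac, map_sub,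
      LinearMap.sub_apply, hY, aeval_theta_of_recurrence hm hxb.rec_eq, aeval_C,
      Module.algebraMap_end_apply, ← smul_sub]
    congr 1
    ext n
    simp
  have hQwc : ∀ n, PowerSeries.coeff n
      ((aeval theta (s.map (fun a => X - C a)).prod : Module.End ℂ (PowerSeries ℂ)) w)
      = m.factorial * ((b n : ℝ) : ℂ) := fun n => by
    rw [hQw, map_smul, smul_eq_mul, PowerSeries.coeff_mk]
  have hbC : PolyBdd β (fun n => ((b n : ℝ) : ℂ)) := by
    obtain ⟨C, hC⟩ := hb
    exact ⟨C, fun n => by rw [Complex.norm_real]; exact hC n⟩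
  have hbd : PolyBdd β (fun n => PowerSeries.coeff n
      ((aeval theta (s.map (fun a => X - C a)).prod : Module.End ℂ (PowerSeries ℂ)) w)) := by
    simp only [hQwc]
    exact hbC.const_mul _
  have hwbd := polyBdd_of_aeval_theta hβ0 s hs hbd
  have hwsum := wsum_aeval_theta hβ0 hβ1 s hs hbd hw0
  simp only [hQwc] at hwsum
  have hwmul : wsum (fun n => (m.factorial : ℂ) * ((b n : ℝ) : ℂ))
      = m.factorial * wsum (fun n => ((b n : ℝ) : ℂ)) := by
    simp only [wsum, mul_div_assoc, tsum_mul_left]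
  rw [hwmul, hQ, wsum_ofReal] at hwsum
  have hH := one_lt_Hm hm
  have hL : wsum (fun n => PowerSeries.coeff n w) = ((growthRate m b : ℝ) : ℂ) := by
    have hH0 : ((Hm m - 1 : ℝ) : ℂ) ≠ 0 := by exact_mod_cast (by linarith : Hm m - 1 ≠ 0)
    have hf0 : (m.factorial : ℂ) ≠ 0 := by exact_mod_cast m.factorial_ne_zero
    rw [growthRate, Complex.ofReal_div, eq_div_iff hH0]
    rw [Complex.ofReal_mul, Complex.ofReal_natCast, mul_assoc] at hwsum
    rw [mul_left_cancel₀ hf0 hwsum, mul_comm]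
  have hfin := linear_growth hβ0 hβ1 (x := Y) (by rw [← hw]; exact hwbd)
  rw [← hw, hL, hY0 0 (by omega), zero_add] at hfin
  obtain ⟨C, hC⟩ := hfin.add hbC
  refine ⟨C, fun n => ?_⟩
  refine le_trans (le_of_eq ?_) (hC n)
  beta_reduce
  rw [hYc, ← Complex.norm_real]
  congr 1
  push_cast
  ring

/-- The expected toll. -/
noncomputable def meanToll (m n : ℕ) : ℝ :=
  if n < m - 1 then 0 else compAvg m n (fun I => (toll m I : ℝ))

theorem isRecurrence_meanProt {m : ℕ} (hm : 2 ≤ m) :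
    IsRecurrence m (meanProt m) (meanToll m) where
  x_of_lt _ hn := meanProt_of_lt hn
  b_of_lt _ hn := if_pos hn
  rec_eq n hn := by
    rw [meanProt_rec hm hn, compAvg_add, meanToll, if_neg (by omega), add_comm]

theorem polyBdd_meanToll {m : ℕ} (hm : 2 ≤ m) {β : ℝ} (hβ : 0 ≤ β) :
    PolyBdd β (meanToll m) := by
  refine ⟨1, fun n => ?_⟩
  rw [one_mul]
  refine le_trans ?_ (one_le_add_one_rpow hβ n)
  rw [meanToll]
  split_ifs with h
  · simp
  · refine (norm_compAvg_le (K := fun _ => 1) fun I _ => ?_).trans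
      (compAvg_const hm (by omega) (1 : ℝ)).le
    rw [Real.norm_of_nonneg (Nat.cast_nonneg _)]
    exact_mod_cast toll_le_one m I

/-- The beta integral `∫ x ^ a (1 - x) ^ b`. -/
noncomputable def betaW (a b : ℕ) : ℝ :=
  (a.factorial : ℝ) * b.factorial / (a + b + 1).factorial

theorem betaW_nonneg (a b : ℕ) : 0 ≤ betaW a b := by
  unfold betaW; positivity

theorem betaW_split (a b : ℕ) : betaW a b = betaW a (b + 1) + betaW (a + 1) b := by
  unfold betaW
  rw [show a + (b + 1) + 1 = (a + b + 1) + 1 by ring, show a + 1 + b + 1 = (a + b + 1) + 1 by ring,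
    Nat.factorial_succ (a + b + 1), Nat.factorial_succ a, Nat.factorial_succ b]
  have : ((a + b + 1).factorial : ℝ) ≠ 0 := by exact_mod_cast Nat.factorial_ne_zero _
  push_cast
  field_simp
  ring

theorem betaW_le (a c K : ℕ) : betaW (a + K) c ≤ c.factorial / ((K : ℝ) + 1) ^ (c + 1) := by
  unfold betaW
  rw [div_le_div_iff₀ (by positivity) (by positivity)]
  have h1 : (a + K).factorial * (a + K + 1) ^ (c + 1) ≤ (a + K + c + 1).factorial :=
    Nat.factorial_mul_pow_le_factorial
  have h2 : (K + 1) ^ (c + 1) ≤ (a + K + 1) ^ (c + 1) := Nat.pow_le_pow_left (by omega) _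
  have h3 : (a + K).factorial * (K + 1) ^ (c + 1) ≤ (a + K + c + 1).factorial :=
    (Nat.mul_le_mul_left _ h2).trans h1
  have h4 : ((a + K).factorial : ℝ) * ((K : ℝ) + 1) ^ (c + 1) ≤ (a + K + c + 1).factorial := by
    exact_mod_cast h3
  nlinarith [Nat.cast_nonneg (α := ℝ) c.factorial]

theorem tendsto_choose_mul_betaW (a b r : ℕ) :
    Filter.Tendsto (fun K : ℕ => ((K + r).choose (r + 1) : ℝ) * betaW (a + K) (b + r + 1))
      Filter.atTop (nhds 0) := by
  have hlim := (tendsto_one_div_add_atTop_nhds_zero_nat (𝕜 := ℝ)).const_mul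
    (((r : ℝ) + 1) ^ (r + 1) * (b + r + 1).factorial)
  rw [mul_zero] at hlim
  refine squeeze_zero (fun K => mul_nonneg (Nat.cast_nonneg _) (betaW_nonneg _ _))
    (fun K => ?_) hlim
  have h1 : ((K + r).choose (r + 1) : ℝ) ≤ (((r : ℝ) + 1) * (K + 1)) ^ (r + 1) := by
    have h2 : (K + r).choose (r + 1) ≤ ((r + 1) * (K + 1)) ^ (r + 1) :=
      (Nat.choose_le_pow _ _).trans (Nat.pow_le_pow_left (by nlinarith) _)
    exact_mod_cast h2
  have hK : (1 : ℝ) ≤ K + 1 := by linarith [K.cast_nonneg (α := ℝ)]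
  have h2 : betaW (a + K) (b + r + 1) ≤ (b + r + 1).factorial / ((K : ℝ) + 1) ^ (r + 2) := by
    refine (betaW_le a _ K).trans ?_
    exact div_le_div_of_nonneg_left (by positivity) (by positivity)
      (pow_le_pow_right₀ hK (by omega))
  refine (mul_le_mul h1 h2 (betaW_nonneg _ _) (by positivity)).trans (le_of_eq ?_)
  rw [mul_pow, pow_succ _ (r + 1)]
  field_simp

theorem hasSum_choose_mul_betaW (a b q : ℕ) :
    HasSum (fun k : ℕ => ((k + q).choose q : ℝ) * betaW (a + k) (b + q + 1)) (betaW a b) := by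
  rw [hasSum_iff_tendsto_nat_of_nonneg
    (fun k => mul_nonneg (Nat.cast_nonneg _) (betaW_nonneg _ _))]
  induction q with
  | zero =>
    have hK : ∀ K : ℕ, ∑ k ∈ Finset.range K,
        ((k + 0).choose 0 : ℝ) * betaW (a + k) (b + 0 + 1) = betaW a b - betaW (a + K) b := by
      intro K
      induction K with
      | zero => simp
      | succ K ih =>
        rw [Finset.sum_range_succ, ih]
        have := betaW_split (a + K) b
        simp only [Nat.choose_zero_right, Nat.cast_one, one_mul, add_zero, ← add_assoc]
        linarith
    have hlim : Filter.Tendsto (fun K : ℕ => betaW (a + K) b) Filter.atTop (nhds 0) := by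
      have hl := (tendsto_one_div_add_atTop_nhds_zero_nat (𝕜 := ℝ)).const_mul
        (b.factorial : ℝ)
      rw [mul_zero] at hl
      refine squeeze_zero (fun K => betaW_nonneg _ _) (fun K => ?_) hl
      refine (betaW_le a b K).trans ?_
      rw [← mul_one_div]
      gcongr
      have hK : (1 : ℝ) ≤ K + 1 := by linarith [K.cast_nonneg (α := ℝ)]
      exact le_self_pow₀ hK (by omega)
    have := hlim.const_sub (betaW a b)
    rw [sub_zero] at this
    exact this.congr fun K => (hK K).symm
  | succ r ih =>
    have hK : ∀ K : ℕ, ∑ k ∈ Finset.range K,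
        ((k + (r + 1)).choose (r + 1) : ℝ) * betaW (a + k) (b + (r + 1) + 1)
          = ∑ k ∈ Finset.range K, ((k + r).choose r : ℝ) * betaW (a + k) (b + r + 1)
            - ((K + r).choose (r + 1) : ℝ) * betaW (a + K) (b + r + 1) := by
      intro K
      induction K with
      | zero => simp
      | succ K ih =>
        rw [Finset.sum_range_succ, ih, Finset.sum_range_succ]
        have h1 := betaW_split (a + K) (b + r + 1)
        have h2 : ((K + (r + 1)).choose (r + 1) : ℝ)
            = (K + r).choose r + (K + r).choose (r + 1) := by
          exact_mod_cast Nat.choose_succ_succ (K + r) r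
        rw [show K + 1 + r = K + (r + 1) by ring, show b + (r + 1) + 1 = b + r + 1 + 1 by ring,
          ← add_assoc a K 1, h1, h2]
        ring
    have := ih.sub (tendsto_choose_mul_betaW a b r)
    rw [sub_zero] at this
    exact this.congr fun K => (hK K).symm

theorem sum_toll {m : ℕ} (hm : 2 ≤ m) (N : ℕ) :
    ∑ I ∈ Finset.piAntidiag (Finset.univ : Finset (Fin m)) N, (toll m I : ℝ)
      = ∑ p ∈ Finset.range m, (m.choose (p + 1) : ℝ)
        * (if m * (p + 1) ≤ N then ((N - m * (p + 1) + p).choose p : ℝ) else 0) := by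
  obtain ⟨E, hE⟩ : ∃ E : PowerSeries ℝ, E = PowerSeries.X ^ m * PowerSeries.mk 1 + 1 := ⟨_, rfl⟩
  have hcoeff : ∀ i, PowerSeries.coeff i E = if 1 ≤ i ∧ i ≤ m - 1 then 0 else 1 := by
    intro i
    rw [hE, map_add, PowerSeries.coeff_X_pow_mul', PowerSeries.coeff_one]
    simp only [PowerSeries.coeff_mk, Pi.one_apply]
    split_ifs <;> first | omega | norm_num
  have h1 : PowerSeries.coeff N (E ^ m) = (if N = 0 then 1 else 0)
      + ∑ p ∈ Finset.range m, (m.choose (p + 1) : ℝ)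
        * (if m * (p + 1) ≤ N then ((N - m * (p + 1) + p).choose p : ℝ) else 0) := by
    rw [hE, add_pow, Finset.sum_range_succ', map_add, map_sum, add_comm]
    congr 1
    · simp [PowerSeries.coeff_one]
    · refine Finset.sum_congr rfl fun p _ => ?_
      rw [one_pow, mul_one, ← map_natCast (PowerSeries.C (R := ℝ)), mul_comm,
        PowerSeries.coeff_C_mul, mul_pow,
        ← pow_mul, PowerSeries.coeff_X_pow_mul', PowerSeries.mk_one_pow_eq_mk_choose_add]
      simp only [PowerSeries.coeff_mk, add_comm p]
  have h2 : PowerSeries.coeff N (E ^ m) = (if N = 0 then 1 else 0)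
      + ∑ I ∈ Finset.piAntidiag (Finset.univ : Finset (Fin m)) N, (toll m I : ℝ) := by
    have h3 : E ^ m = ∏ _i : Fin m, E := by simp
    rw [h3, coeff_prod_fin]
    simp only [hcoeff]
    by_cases hN : N = 0
    · subst hN
      simp only [Finset.piAntidiag_zero, Finset.sum_singleton, toll]
      simp
    · rw [if_neg hN, zero_add]
      refine Finset.sum_congr rfl fun I hI => ?_
      have hs := (Finset.mem_piAntidiag.1 hI).1
      rw [toll]
      by_cases hall : ∀ i, ¬ (1 ≤ I i ∧ I i ≤ m - 1)
      · rw [if_pos ⟨by rw [hs]; exact hN, hall⟩,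
          Finset.prod_congr rfl fun i _ => if_neg (hall i)]
        simp
      · rw [if_neg fun h => hall h.2]
        push Not at hall
        obtain ⟨i, hi⟩ := hall
        rw [Finset.prod_eq_zero (f := fun i => if 1 ≤ I i ∧ I i ≤ m - 1 then (0 : ℝ) else 1)
          (Finset.mem_univ i) (if_pos hi)]
        simp
  linarith

theorem inv_choose_div {k : ℕ} (N : ℕ) :
    ((N + k).choose k : ℝ)⁻¹ / ((((N + k : ℕ) : ℝ) + 1) * (((N + k : ℕ) : ℝ) + 2))
      = 1 / ((k + 1 : ℕ) : ℝ) * betaW N (k + 1) := by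
  have h1 : ((N + k).choose k : ℝ) * k.factorial * N.factorial = (N + k).factorial := by
    have := Nat.add_choose_mul_factorial_mul_factorial N k
    rw [← this]; push_cast; ring
  have h2 : (N + (k + 1) + 1).factorial = (N + k + 2) * ((N + k + 1) * (N + k).factorial) := by
    rw [show N + (k + 1) + 1 = N + k + 1 + 1 by ring, Nat.factorial_succ, Nat.factorial_succ]
  have h3 : ((N + k).choose k : ℝ) ≠ 0 := by exact_mod_cast (Nat.choose_pos (by omega)).ne'
  have h4 : (k.factorial : ℝ) ≠ 0 := by exact_mod_cast k.factorial_ne_zero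
  have h5 : (N.factorial : ℝ) ≠ 0 := by exact_mod_cast N.factorial_ne_zero
  rw [betaW, h2, Nat.factorial_succ k]
  push_cast
  rw [← h1]
  field_simp

theorem hasSum_shift {f g : ℕ → ℝ} {s : ℝ} (d : ℕ) (hg : HasSum g s) (h0 : ∀ n < d, f n = 0)
    (h : ∀ n, f (n + d) = g n) : HasSum f s := by
  rw [← hasSum_nat_add_iff' d, Finset.sum_eq_zero fun n hn => h0 n (Finset.mem_range.1 hn),
    sub_zero]
  simpa only [h] using hg

theorem growthRate_meanToll {m : ℕ} (hm : 2 ≤ m) : growthRate m (meanToll m) = muProt m := by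
  obtain ⟨k, rfl⟩ := Nat.exists_eq_add_of_le' (show 1 ≤ m by omega)
  have hsum : HasSum (fun n : ℕ => meanToll (k + 1) n / (((n : ℝ) + 1) * (n + 2)))
      (∑ p ∈ Finset.range (k + 1), 1 / ((k + 1 : ℕ) : ℝ) * (((k + 1).choose (p + 1) : ℝ)
        * betaW ((k + 1) * (p + 1)) (k - p))) := by
    refine hasSum_shift k (g := fun N => ∑ p ∈ Finset.range (k + 1),
      1 / ((k + 1 : ℕ) : ℝ) * (((k + 1).choose (p + 1) : ℝ)
        * ((if (k + 1) * (p + 1) ≤ N then ((N - (k + 1) * (p + 1) + p).choose p : ℝ) else 0)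
          * betaW N (k + 1)))) ?_ (fun n hn => ?_) fun N => ?_
    · refine hasSum_sum fun p hp => (HasSum.mul_left _ (HasSum.mul_left _ ?_))
      refine hasSum_shift ((k + 1) * (p + 1))
        (hasSum_choose_mul_betaW ((k + 1) * (p + 1)) (k - p) p) (fun n hn => ?_) fun n => ?_
      · rw [if_neg (by omega), zero_mul]
      · have hp := Finset.mem_range.1 hp
        rw [if_pos (by omega), Nat.add_sub_cancel, show k - p + p + 1 = k + 1 by omega,
          add_comm n ((k + 1) * (p + 1))]
    · rw [meanToll, if_pos (by simpa using hn), zero_div]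
    · rw [meanToll, if_neg (by omega), compAvg, show N + k - (k + 1 - 1) = N by omega,
        sum_toll hm, Nat.add_sub_cancel, smul_eq_mul, mul_div_right_comm, inv_choose_div,
        Finset.mul_sum]
      exact Finset.sum_congr rfl fun p _ => by ring
  rw [growthRate, hsum.tsum_eq, muProt, ← Finset.mul_sum, div_eq_mul_one_div, mul_right_comm,
    one_div_mul_one_div]
  congr 1
  rw [← Finset.sum_range_reflect]
  refine Finset.sum_congr rfl fun l hl => ?_
  have hl := Finset.mem_range.1 hl
  rw [show k + 1 - 1 - l + 1 = k + 1 - l by omega, show k - (k + 1 - 1 - l) = l by omega, betaW]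
  have h1 : ((k + 1).choose (k + 1 - l) : ℝ) * (k + 1 - l).factorial * l.factorial
      = (k + 1).factorial := by
    have := Nat.choose_mul_factorial_mul_factorial (show k + 1 - l ≤ k + 1 by omega)
    rw [show k + 1 - (k + 1 - l) = l by omega] at this
    exact_mod_cast this
  have h2 : ((k + 1 - l).factorial : ℝ) ≠ 0 := by exact_mod_cast Nat.factorial_ne_zero _
  rw [← h1]
  field_simp

theorem polyBdd_meanProt_sub {m : ℕ} (hm : 2 ≤ m) {β : ℝ} (hβ : 0 ≤ β)
    (h : IsErrorExponent m β) : PolyBdd β (fun n => meanProt m n - muProt m * (n + 1)) := by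
  rw [← growthRate_meanToll hm]
  exact h _ _ (isRecurrence_meanProt hm) (polyBdd_meanToll hm hβ)

theorem apply_le_of_sum_eq {m n N : ℕ} {I : Fin m → ℕ} (h : ∑ i, I i = N) (hN : N ≤ n)
    (i : Fin m) : I i ≤ n :=
  (Finset.single_le_sum (f := I) (fun _ _ => Nat.zero_le _) (Finset.mem_univ i)).trans (by omega)

theorem abs_le_rpow_of_le {β C : ℝ} (hβ : 0 ≤ β) {x : ℕ → ℝ}
    (hC : ∀ n, ‖x n‖ ≤ C * ((n : ℝ) + 1) ^ β) {k n : ℕ} (hk : k ≤ n) :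
    |x k| ≤ C * ((n : ℝ) + 1) ^ β := by
  have hC0 : 0 ≤ C := by simpa using (norm_nonneg _).trans (hC 0)
  refine (hC k).trans ?_
  have : (k : ℝ) ≤ n := by exact_mod_cast hk
  gcongr

/-- Sums of a linearly growing sequence over the subtree sizes, compared with its value at the
total size. -/
theorem exists_abs_sum_sub_le {m : ℕ} (hm : 2 ≤ m) {β L : ℝ} (hβ : 0 ≤ β) {x : ℕ → ℝ}
    (hx : PolyBdd β (fun n => x n - L * (n + 1))) :
    ∃ C, 0 ≤ C ∧ ∀ n, m - 1 ≤ n → ∀ I : Fin m → ℕ, ∑ i, I i = n - (m - 1) →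
      |∑ i, x (I i) - x n| ≤ C * ((n : ℝ) + 1) ^ β := by
  obtain ⟨C, hC⟩ := hx
  have hC0 : 0 ≤ C := by simpa using (norm_nonneg _).trans (hC 0)
  refine ⟨m * C + C, by positivity, fun n hn I hI => ?_⟩
  have hsum : ∑ i, ((I i : ℝ) + 1) = n + 1 := by
    have h1 : ∑ i, (I i + 1) = n + 1 := by
      rw [Finset.sum_add_distrib, hI]; simp; omega
    exact_mod_cast h1
  have e : ∑ i, x (I i) - x n
      = ∑ i, (x (I i) - L * (I i + 1)) - (x n - L * (n + 1)) := by
    rw [Finset.sum_sub_distrib, ← Finset.mul_sum, hsum]; ring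
  have h1 : |∑ i, (x (I i) - L * (I i + 1))| ≤ m * (C * ((n : ℝ) + 1) ^ β) := by
    refine (Finset.abs_sum_le_sum_abs _ _).trans ?_
    refine (Finset.sum_le_sum fun i _ => abs_le_rpow_of_le (n := n) hβ hC
      (apply_le_of_sum_eq hI (by omega) i)).trans ?_
    simp
  have h2 := abs_le_rpow_of_le hβ hC (le_refl n)
  rw [e]
  refine (abs_sub _ _).trans ?_
  beta_reduce at h2
  linarith

theorem exists_abs_meanDiff_le {m : ℕ} (hm : 2 ≤ m) {β : ℝ} (hβ : 0 ≤ β)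
    (h : IsErrorExponent m β) :
    ∃ C, 0 ≤ C ∧ ∀ n, m - 1 ≤ n → ∀ I : Fin m → ℕ, ∑ i, I i = n - (m - 1) →
      |meanDiff m n I| ≤ C * ((n : ℝ) + 1) ^ β := by
  obtain ⟨C, hC0, hC⟩ := exists_abs_sum_sub_le hm hβ (polyBdd_meanProt_sub hm hβ h)
  refine ⟨1 + C, by positivity, fun n hn I hI => ?_⟩
  have e : meanDiff m n I = toll m I + (∑ i, meanProt m (I i) - meanProt m n) := by
    rw [meanDiff]; ring
  have h1 : |(toll m I : ℝ)| ≤ 1 := by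
    rw [abs_of_nonneg (Nat.cast_nonneg _)]; exact_mod_cast toll_le_one m I
  rw [e]
  refine (abs_add_le _ _).trans ?_
  have := hC n hn I hI
  have h2 := one_le_add_one_rpow hβ n
  linarith

theorem meanProt_of_le {m n : ℕ} (hm : 2 ≤ m) (hn : n ≤ m) : meanProt m n = 0 := by
  have h1 : ∀ k ≤ m - 1, meanProt m k = 0 := by
    intro k hk
    rcases hk.lt_or_eq with hk | rfl
    · exact meanProt_of_lt hk
    · rw [meanProt_rec hm le_rfl, compAvg_congr (H' := fun _ => (0 : ℝ)),
        compAvg_const hm le_rfl]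
      intro I hI
      rw [Nat.sub_self] at hI
      rw [toll, if_neg (fun h => h.1 hI), Finset.sum_eq_zero]
      · simp
      · exact fun i hi => meanProt_of_lt (by
          rw [(Finset.sum_eq_zero_iff.1 hI) i hi]; omega)
  rcases hn.lt_or_eq with hn | rfl
  · exact h1 n (by omega)
  · rw [meanProt_rec hm (by omega), compAvg_congr (H' := fun _ => (0 : ℝ)),
      compAvg_const hm (by omega)]
    intro I hI
    have hle := fun i => apply_le_of_sum_eq hI (show n - (n - 1) ≤ 1 by omega) i
    rw [toll, if_neg, Finset.sum_eq_zero]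
    · simp
    · exact fun i _ => h1 _ ((hle i).trans (by omega))
    · rintro ⟨h0, hall⟩
      refine h0 (Finset.sum_eq_zero fun i _ => ?_)
      have := hall i
      have := hle i
      omega

/-- The solution of the recurrence with toll `b`. -/
noncomputable def recSol (m : ℕ) (b : ℕ → ℝ) (n : ℕ) : ℝ :=
  if n < m - 1 then 0
  else compAvg m n (fun I => ∑ i, if _h : I i < n then recSol m b (I i) else 0) + b n
termination_by n

theorem isRecurrence_recSol {m : ℕ} (hm : 2 ≤ m) {b : ℕ → ℝ} (hb : ∀ n < m - 1, b n = 0) :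
    IsRecurrence m (recSol m b) b where
  x_of_lt n hn := by rw [recSol, if_pos hn]
  b_of_lt := hb
  rec_eq n hn := by
    rw [recSol, if_neg (by omega)]
    congr 1
    refine compAvg_congr fun I hI => Finset.sum_congr rfl fun i _ => dif_pos ?_
    have := apply_le_of_sum_eq hI le_rfl i
    omega

theorem recSol_nonneg {m : ℕ} {b : ℕ → ℝ} (hb : ∀ n, 0 ≤ b n) (n : ℕ) : 0 ≤ recSol m b n := by
  induction n using Nat.strong_induction_on with
  | _ n ih =>
    rw [recSol]
    split_ifs with hn
    · exact le_rfl
    · refine add_nonneg (compAvg_nonneg fun I => Finset.sum_nonneg fun i _ => ?_) (hb n)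
      split_ifs with h
      · exact ih _ h
      · exact le_rfl

/-- The toll of the variance recurrence. -/
noncomputable def varToll (m n : ℕ) : ℝ :=
  if n < m - 1 then 0 else compAvg m n (fun I => meanDiff m n I ^ 2)

/-- The solution of the variance recurrence. -/
noncomputable def varSeq (m : ℕ) : ℕ → ℝ := recSol m (varToll m)

theorem isRecurrence_varSeq {m : ℕ} (hm : 2 ≤ m) : IsRecurrence m (varSeq m) (varToll m) :=
  isRecurrence_recSol hm fun _ hn => if_pos hn

theorem varToll_nonneg (m n : ℕ) : 0 ≤ varToll m n := by
  rw [varToll]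
  split_ifs
  · exact le_rfl
  · exact compAvg_nonneg fun I => sq_nonneg _

theorem varSeq_nonneg (m n : ℕ) : 0 ≤ varSeq m n :=
  recSol_nonneg (varToll_nonneg m) n

theorem polyBdd_varToll {m : ℕ} (hm : 2 ≤ m) {β : ℝ} (hβ : 0 ≤ β)
    (h : IsErrorExponent m β) : PolyBdd (2 * β) (varToll m) := by
  obtain ⟨C, hC0, hC⟩ := exists_abs_meanDiff_le hm hβ h
  refine ⟨C ^ 2, fun n => ?_⟩
  rw [varToll]
  split_ifs with hn
  · rw [norm_zero]; positivity
  · refine (norm_compAvg_le (K := fun _ => C ^ 2 * ((n : ℝ) + 1) ^ (2 * β)) fun I hI => ?_).trans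
      (compAvg_const hm (by omega) _).le
    have e : ((n : ℝ) + 1) ^ (2 * β) = (((n : ℝ) + 1) ^ β) ^ 2 := by
      rw [mul_comm, Real.rpow_mul (by positivity)]
      exact_mod_cast rfl
    rw [e, ← mul_pow, norm_pow, Real.norm_eq_abs]
    exact pow_le_pow_left₀ (abs_nonneg _) (hC n (by omega) I hI) 2

theorem varToll_pos {m : ℕ} (hm : 2 ≤ m) : 0 < varToll m (2 * m - 1) := by
  obtain ⟨i0, hi0⟩ : ∃ i0 : Fin m, i0 = ⟨0, by omega⟩ := ⟨_, rfl⟩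
  obtain ⟨i1, hi1⟩ : ∃ i1 : Fin m, i1 = ⟨1, by omega⟩ := ⟨_, rfl⟩
  have hne : i1 ≠ i0 := by rw [hi0, hi1]; simp
  obtain ⟨I, hI⟩ : ∃ I : Fin m → ℕ, I = fun i => if i = i0 then m else 0 := ⟨_, rfl⟩
  obtain ⟨J, hJ⟩ : ∃ J : Fin m → ℕ,
    J = fun i => (if i = i0 then m - 1 else 0) + (if i = i1 then 1 else 0) := ⟨_, rfl⟩
  have hIs : ∑ i, I i = m := by simp [hI]
  have hJs : ∑ i, J i = m := by
    rw [hJ, Finset.sum_add_distrib]; simp; omega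
  have hmem : ∀ K : Fin m → ℕ, ∑ i, K i = m →
      K ∈ Finset.piAntidiag (Finset.univ : Finset (Fin m)) (2 * m - 1 - (m - 1)) := by
    intro K hK
    exact Finset.mem_piAntidiag.2 ⟨hK.trans (by omega), fun i _ => Finset.mem_univ i⟩
  have hz : ∀ K : Fin m → ℕ, ∑ i, K i = m → ∑ i, meanProt m (K i) = 0 := fun K hK =>
    Finset.sum_eq_zero fun i _ => meanProt_of_le hm (apply_le_of_sum_eq hK le_rfl i)
  have htI : toll m I = 1 := by
    rw [toll, if_pos]
    refine ⟨by omega, fun i => ?_⟩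
    rw [hI]
    dsimp only
    split_ifs <;> omega
  have htJ : toll m J = 0 := by
    rw [toll, if_neg]
    rintro ⟨-, hall⟩
    refine hall i1 ?_
    rw [hJ]
    simp [hne]
    omega
  have hdiff : meanDiff m (2 * m - 1) I ≠ 0 ∨ meanDiff m (2 * m - 1) J ≠ 0 := by
    by_contra! hcon
    obtain ⟨h1, h2⟩ := hcon
    rw [meanDiff, hz I hIs, htI] at h1
    rw [meanDiff, hz J hJs, htJ] at h2
    push_cast at h1 h2
    linarith
  have hpos : ∀ K : Fin m → ℕ, ∑ i, K i = m → meanDiff m (2 * m - 1) K ≠ 0 →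
      0 < varToll m (2 * m - 1) := by
    intro K hK hK0
    rw [varToll, if_neg (by omega), compAvg, smul_eq_mul]
    refine mul_pos (inv_pos.2 (by exact_mod_cast Nat.choose_pos (by omega))) ?_
    exact Finset.sum_pos' (fun _ _ => sq_nonneg _) ⟨K, hmem K hK, by positivity⟩
  rcases hdiff with h | h
  · exact hpos I hIs h
  · exact hpos J hJs h

theorem growthRate_varToll_pos {m : ℕ} (hm : 2 ≤ m) {β : ℝ} (hβ : 0 < β) (hβ' : 2 * β < 1)
    (h : IsErrorExponent m β) : 0 < growthRate m (varToll m) := by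
  refine div_pos ?_ (by linarith [one_lt_Hm hm])
  have hsum : Summable fun n : ℕ => varToll m n / (((n : ℝ) + 1) * (n + 2)) := by
    obtain ⟨C, hC⟩ := polyBdd_varToll hm hβ.le h
    refine Summable.of_norm_bounded ((summable_rpow_weight (by linarith) hβ').mul_left C)
      fun n => ?_
    rw [norm_div, Real.norm_of_nonneg (show 0 ≤ ((n : ℝ) + 1) * (n + 2) by positivity),
      mul_div_assoc']
    exact div_le_div_of_nonneg_right (hC n) (by positivity)
  refine hsum.tsum_pos (fun n => div_nonneg (varToll_nonneg m n) (by positivity)) (2 * m - 1) ?_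
  exact div_pos (varToll_pos hm) (by positivity)

theorem compAvg_meanDiff_sq {m n : ℕ} (hm : 2 ≤ m) (hn : m - 1 ≤ n) :
    compAvg m n (fun I => meanDiff m n I ^ 2 + (∑ i, varSeq m (I i) - varSeq m n)) = 0 := by
  have h := (isRecurrence_varSeq hm).rec_eq n hn
  rw [varToll, if_neg (by omega)] at h
  rw [compAvg_add, compAvg_sub, compAvg_const hm hn]
  linarith

theorem norm_prod_sub_prod_le_sum {ι : Type*} (s : Finset ι) {a b : ι → ℂ}
    (ha : ∀ i, ‖a i‖ ≤ 1) (hb : ∀ i, ‖b i‖ ≤ 1) :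
    ‖∏ i ∈ s, a i - ∏ i ∈ s, b i‖ ≤ ∑ i ∈ s, ‖a i - b i‖ := by
  classical
  induction s using Finset.induction_on with
  | empty => simp
  | insert j s hj ih =>
    rw [Finset.prod_insert hj, Finset.prod_insert hj, Finset.sum_insert hj]
    have e : a j * ∏ i ∈ s, a i - b j * ∏ i ∈ s, b i
        = (a j - b j) * ∏ i ∈ s, a i + b j * (∏ i ∈ s, a i - ∏ i ∈ s, b i) := by ring
    have h1 : ‖∏ i ∈ s, a i‖ ≤ 1 := by
      rw [norm_prod]
      exact Finset.prod_le_one (fun _ _ => norm_nonneg _) fun i _ => ha i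
    rw [e]
    refine (norm_add_le _ _).trans (add_le_add ?_ ?_)
    · rw [norm_mul]
      exact mul_le_of_le_one_right (norm_nonneg _) h1
    · rw [norm_mul]
      exact (mul_le_of_le_one_left (norm_nonneg _) (hb j)).trans ih

/-- Second order expansion of `exp (a * I - u / 2)` when `a = O(s)` and `u = O(s ^ 2)`. -/
theorem norm_exp_sub_expansion_le {A B a u s : ℝ} (hA : 0 ≤ A) (hB : 0 ≤ B) (hs : 0 ≤ s)
    (hs1 : s ≤ 1) (ha : |a| ≤ A * s) (hu : |u| ≤ B * s ^ 2) :
    ‖Complex.exp (a * Complex.I - u / 2) - 1 - (a * Complex.I - (a ^ 2 + u) / 2)‖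
      ≤ ((A + B) ^ 3 * Real.exp (A + B) + A * B + B ^ 2) * s ^ 3 := by
  obtain ⟨z, hz⟩ : ∃ z : ℂ, z = a * Complex.I - u / 2 := ⟨_, rfl⟩
  have hu2 : |u| ≤ B * s := hu.trans (mul_le_mul_of_nonneg_left (by nlinarith) hB)
  have hzn : ‖z‖ ≤ (A + B) * s := by
    rw [hz]
    refine (norm_sub_le _ _).trans ?_
    rw [norm_mul, norm_div, Complex.norm_I, Complex.norm_real, Complex.norm_real,
      Real.norm_eq_abs, Real.norm_eq_abs, Complex.norm_ofNat]
    linarith [abs_nonneg u]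
  have h1 := Complex.norm_exp_sub_sum_le_norm_mul_exp z 3
  have h2 : ‖z‖ ^ 3 * Real.exp ‖z‖ ≤ ((A + B) * s) ^ 3 * Real.exp (A + B) := by
    gcongr
    exact hzn.trans (mul_le_of_le_one_right (by positivity) hs1)
  have e : Complex.exp z - 1 - (a * Complex.I - (a ^ 2 + u) / 2)
      = (Complex.exp z - ∑ k ∈ Finset.range 3, z ^ k / (k.factorial : ℂ))
        + (((-(a * u) / 2 : ℝ) : ℂ) * Complex.I + ((u ^ 2 / 8 : ℝ) : ℂ)) := by
    simp only [Finset.sum_range_succ, Finset.sum_range_zero]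
    rw [hz]
    push_cast [Nat.factorial]
    linear_combination (a ^ 2 / 2 : ℂ) * Complex.I_sq
  have h3 : |a| * |u| ≤ A * B * s ^ 3 := by
    calc |a| * |u| ≤ (A * s) * (B * s ^ 2) := by gcongr
      _ = _ := by ring
  have h4 : u ^ 2 ≤ B ^ 2 * s ^ 3 := by
    calc u ^ 2 = |u| * |u| := by rw [← sq, sq_abs]
      _ ≤ (B * s) * (B * s ^ 2) := by gcongr
      _ = _ := by ring
  rw [← hz, e]
  refine (norm_add_le _ _).trans ((add_le_add (h1.trans h2) (norm_add_le _ _)).trans ?_)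
  rw [norm_mul, Complex.norm_I, Complex.norm_real, Complex.norm_real, Real.norm_eq_abs,
    Real.norm_eq_abs, abs_div, abs_neg, abs_mul, abs_of_nonneg (show 0 ≤ u ^ 2 / 8 by positivity),
    abs_two]
  have h5 : 0 ≤ |a| * |u| := by positivity
  nlinarith [sq_nonneg u]

/-- The characteristic function of the Gaussian law matching `cf`. -/
noncomputable def gaussCf (m n : ℕ) (t : ℝ) : ℂ := ((Real.exp (-(varSeq m n * t ^ 2) / 2) : ℝ) : ℂ)

theorem norm_gaussCf_le (m n : ℕ) (t : ℝ) : ‖gaussCf m n t‖ ≤ 1 := by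
  rw [gaussCf, Complex.norm_real, Real.norm_eq_abs, Real.abs_exp, Real.exp_le_one_iff]
  have := mul_nonneg (varSeq_nonneg m n) (sq_nonneg t)
  linarith

theorem gaussCf_of_lt {m n : ℕ} (hm : 2 ≤ m) (hn : n < m - 1) (t : ℝ) : gaussCf m n t = 1 := by
  simp [gaussCf, (isRecurrence_varSeq hm).x_of_lt n hn]

theorem exists_norm_compAvg_gaussCf_sub_le {m : ℕ} (hm : 2 ≤ m) {β p : ℝ} (hβ : 0 < β)
    (hβ' : 2 * β < 1) (h : IsErrorExponent m β) (h2 : IsErrorExponent m (2 * β))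
    (hp : 0 ≤ p) (hp3 : p ≤ 3) :
    ∃ C, 0 ≤ C ∧ ∀ n, m - 1 ≤ n → ∀ t : ℝ,
      ‖compAvg m n (fun I => Complex.exp (((t * meanDiff m n I : ℝ) : ℂ) * Complex.I)
        * ∏ i, gaussCf m (I i) t) - gaussCf m n t‖ ≤ C * (|t| * ((n : ℝ) + 1) ^ β) ^ p := by
  obtain ⟨A, hA, hW⟩ := exists_abs_meanDiff_le hm hβ.le h
  obtain ⟨B, hB, hU⟩ := exists_abs_sum_sub_le hm (by positivity)
    (h2 _ _ (isRecurrence_varSeq hm) (polyBdd_varToll hm hβ.le h))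
  obtain ⟨C, hC⟩ : ∃ C, C = (A + B) ^ 3 * Real.exp (A + B) + A * B + B ^ 2 := ⟨_, rfl⟩
  have hC0 : 0 ≤ C := by rw [hC]; positivity
  refine ⟨max C 2, le_max_of_le_left hC0, fun n hn t => ?_⟩
  obtain ⟨s, hs⟩ : ∃ s, s = |t| * ((n : ℝ) + 1) ^ β := ⟨_, rfl⟩
  have hs0 : 0 ≤ s := by rw [hs]; positivity
  have hmax : 0 ≤ max C 2 := le_max_of_le_left hC0
  rw [← hs]
  rcases le_or_gt s 1 with hs1 | hs1
  swap
  · have h1 : 1 ≤ s ^ p := Real.one_le_rpow hs1.le hp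
    have h3 : ‖compAvg m n (fun I => Complex.exp (((t * meanDiff m n I : ℝ) : ℂ) * Complex.I)
        * ∏ i, gaussCf m (I i) t)‖ ≤ 1 := by
      refine (norm_compAvg_le (K := fun _ => 1) fun I _ => ?_).trans (compAvg_const hm hn _).le
      rw [norm_mul, Complex.norm_exp_ofReal_mul_I, one_mul, norm_prod]
      exact Finset.prod_le_one (fun _ _ => norm_nonneg _) fun i _ => norm_gaussCf_le _ _ _
    have h4 := norm_sub_le (compAvg m n (fun I =>
      Complex.exp (((t * meanDiff m n I : ℝ) : ℂ) * Complex.I)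
        * ∏ i, gaussCf m (I i) t)) (gaussCf m n t)
    have h5 := norm_gaussCf_le m n t
    have h6 : 2 ≤ max C 2 := le_max_right _ _
    nlinarith
  obtain ⟨a, ha⟩ : ∃ a : (Fin m → ℕ) → ℝ, a = fun I => t * meanDiff m n I := ⟨_, rfl⟩
  obtain ⟨u, hu⟩ : ∃ u : (Fin m → ℕ) → ℝ,
    u = fun I => t ^ 2 * (∑ i, varSeq m (I i) - varSeq m n) := ⟨_, rfl⟩
  have hprod : ∀ I : Fin m → ℕ, Complex.exp (((t * meanDiff m n I : ℝ) : ℂ) * Complex.I)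
        * ∏ i, gaussCf m (I i) t
      = gaussCf m n t * Complex.exp (a I * Complex.I - u I / 2) := by
    intro I
    simp only [gaussCf, Complex.ofReal_exp]
    rw [← Complex.exp_sum, ← Complex.exp_add, ← Complex.exp_add, ha, hu]
    congr 1
    push_cast
    rw [← Finset.sum_div, Finset.sum_neg_distrib, ← Finset.sum_mul]
    ring
  have hzero : compAvg m n (fun I => (a I * Complex.I - ((a I : ℂ) ^ 2 + u I) / 2)) = 0 := by
    have h1 : compAvg m n (fun I => ((meanDiff m n I : ℝ) : ℂ)) = 0 := by
      rw [compAvg_ofReal, compAvg_meanDiff hm hn, Complex.ofReal_zero]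
    have h3 : compAvg m n (fun I => ((meanDiff m n I ^ 2
        + (∑ i, varSeq m (I i) - varSeq m n) : ℝ) : ℂ)) = 0 := by
      rw [compAvg_ofReal, compAvg_meanDiff_sq hm hn, Complex.ofReal_zero]
    have e : (fun I => ((a I : ℂ) * Complex.I - ((a I : ℂ) ^ 2 + u I) / 2))
        = fun I => (t * Complex.I : ℂ) * ((meanDiff m n I : ℝ) : ℂ)
          - (t ^ 2 / 2 : ℂ) * ((meanDiff m n I ^ 2
            + (∑ i, varSeq m (I i) - varSeq m n) : ℝ) : ℂ) := by
      funext I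
      rw [ha, hu]
      push_cast
      ring
    rw [e, compAvg_sub, compAvg_mul_left, compAvg_mul_left, h1, h3]
    simp
  have hmain : compAvg m n (fun I => Complex.exp (((t * meanDiff m n I : ℝ) : ℂ) * Complex.I)
        * ∏ i, gaussCf m (I i) t) - gaussCf m n t
      = gaussCf m n t * compAvg m n (fun I => Complex.exp (a I * Complex.I - u I / 2) - 1
        - (a I * Complex.I - ((a I : ℂ) ^ 2 + u I) / 2)) := by
    rw [compAvg_sub, hzero, compAvg_sub, compAvg_const hm hn]
    simp only [hprod]
    rw [compAvg_mul_left]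
    ring
  rw [hmain, norm_mul]
  refine (mul_le_of_le_one_left (norm_nonneg _) (norm_gaussCf_le _ _ _)).trans ?_
  refine (norm_compAvg_le (K := fun _ => C * s ^ 3) fun I hI => ?_).trans ?_
  · rw [hC]
    refine norm_exp_sub_expansion_le hA hB hs0 hs1 ?_ ?_
    · rw [ha, hs, abs_mul]
      calc |t| * |meanDiff m n I| ≤ |t| * (A * ((n : ℝ) + 1) ^ β) := by
            gcongr; exact hW n hn I hI
        _ = _ := by ring
    · have e : ((n : ℝ) + 1) ^ (2 * β) = (((n : ℝ) + 1) ^ β) ^ 2 := by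
        rw [mul_comm, Real.rpow_mul (by positivity)]
        exact_mod_cast rfl
      rw [hu, hs, abs_mul, abs_pow]
      calc |t| ^ 2 * |∑ i, varSeq m (I i) - varSeq m n|
          ≤ |t| ^ 2 * (B * ((n : ℝ) + 1) ^ (2 * β)) := by
            gcongr; exact hU n hn I hI
        _ = _ := by rw [e]; ring
  · rw [compAvg_const hm hn]
    have h1 : s ^ 3 ≤ s ^ p := by
      rw [← Real.rpow_natCast]
      rcases hs0.eq_or_lt with h0 | h0
      · rw [← h0, Real.zero_rpow (by norm_num)]
        exact Real.rpow_nonneg le_rfl _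
      · exact Real.rpow_le_rpow_of_exponent_ge h0 hs1 (by exact_mod_cast hp3)
    exact mul_le_mul (le_max_left _ _) h1 (by positivity) hmax

theorem exists_norm_cf_sub_gaussCf_le {m : ℕ} (hm : 2 ≤ m) {β p : ℝ} (hβ : 0 < β)
    (hβ' : 2 * β < 1) (h : IsErrorExponent m β) (h2 : IsErrorExponent m (2 * β))
    (hp : 0 ≤ p) (hp3 : p ≤ 3) (hpβ : β * p < 1) (h3 : IsErrorExponent m (β * p)) :
    ∃ C, ∀ n t, ‖cf m n t - gaussCf m n t‖ ≤ C * |t| ^ p * ((n : ℝ) + 1) := by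
  obtain ⟨C, hC0, hC⟩ := exists_norm_compAvg_gaussCf_sub_le hm hβ hβ' h h2 hp hp3
  obtain ⟨b, hb⟩ : ∃ b : ℕ → ℝ,
    b = fun n => if n < m - 1 then 0 else C * ((n : ℝ) + 1) ^ (β * p) := ⟨_, rfl⟩
  have hrec := isRecurrence_recSol hm (b := b) fun n hn => by rw [hb]; exact if_pos hn
  have hb0 : ∀ n, 0 ≤ b n := by
    intro n
    rw [hb]
    dsimp only
    split_ifs <;> positivity
  have hind : ∀ n t, ‖cf m n t - gaussCf m n t‖ ≤ |t| ^ p * recSol m b n := by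
    intro n
    induction n using Nat.strong_induction_on with
    | _ n ih =>
      intro t
      rcases lt_or_ge n (m - 1) with hn | hn
      · rw [cf_of_lt hn, gaussCf_of_lt hm hn, hrec.x_of_lt n hn]
        simp
      have h4 := hC n hn t
      obtain ⟨G, hG⟩ : ∃ G, G = compAvg m n (fun I =>
        Complex.exp (((t * meanDiff m n I : ℝ) : ℂ) * Complex.I)
          * ∏ i, gaussCf m (I i) t) := ⟨_, rfl⟩
      have h5 : ‖cf m n t - G‖
          ≤ |t| ^ p * compAvg m n (fun I => ∑ i, recSol m b (I i)) := by
        rw [hG, cf_rec hm hn, ← compAvg_sub, ← compAvg_mul_left]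
        refine norm_compAvg_le fun I hI => ?_
        rw [← mul_sub, norm_mul, Complex.norm_exp_ofReal_mul_I, one_mul, Finset.mul_sum]
        refine (norm_prod_sub_prod_le_sum _ (fun i => norm_cf_le _ _ _)
          (fun i => norm_gaussCf_le _ _ _)).trans (Finset.sum_le_sum fun i _ => ?_)
        have := apply_le_of_sum_eq hI le_rfl i
        exact ih (I i) (by omega) t
      have h6 : C * (|t| * ((n : ℝ) + 1) ^ β) ^ p = |t| ^ p * b n := by
        rw [hb]
        dsimp only
        rw [if_neg (by omega), Real.mul_rpow (abs_nonneg _) (by positivity),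
          ← Real.rpow_mul (by positivity)]
        ring
      rw [← hG, h6] at h4
      rw [hrec.rec_eq n hn, mul_add]
      refine (norm_sub_le_norm_sub_add_norm_sub _ G _).trans (add_le_add h5 h4)
  have hbb : PolyBdd (β * p) b := by
    refine ⟨C, fun n => ?_⟩
    rw [hb]
    dsimp only
    split_ifs
    · rw [norm_zero]; positivity
    · exact (Real.norm_of_nonneg (by positivity)).le
  obtain ⟨D, hD⟩ := h3 _ _ hrec hbb
  have hD0 : 0 ≤ D := by simpa using (norm_nonneg _).trans (hD 0)
  refine ⟨D + growthRate m b, fun n t => (hind n t).trans ?_⟩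
  have h4 : ((n : ℝ) + 1) ^ (β * p) ≤ (n : ℝ) + 1 := by
    refine (Real.rpow_le_rpow_of_exponent_le ?_ hpβ.le).trans (Real.rpow_one _).le
    linarith [n.cast_nonneg (α := ℝ)]
  have h5 : recSol m b n ≤ (D + growthRate m b) * ((n : ℝ) + 1) := by
    have := (le_abs_self _).trans (hD n)
    nlinarith
  calc |t| ^ p * recSol m b n ≤ |t| ^ p * ((D + growthRate m b) * ((n : ℝ) + 1)) := by gcongr
    _ = _ := by ring

theorem PolyBdd.tendsto_div_rpow {β γ : ℝ} (hβ : 0 ≤ β) (hγ : β < γ) {y : ℕ → ℝ}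
    (h : PolyBdd β y) :
    Filter.Tendsto (fun n : ℕ => y n / (n : ℝ) ^ γ) Filter.atTop (nhds 0) := by
  obtain ⟨C, hC⟩ := h
  have hC0 : 0 ≤ C := by simpa using (norm_nonneg _).trans (hC 0)
  have h1 : Filter.Tendsto (fun n : ℕ => C * 2 ^ β * (n : ℝ) ^ (-(γ - β)))
      Filter.atTop (nhds 0) := by
    simpa using ((tendsto_rpow_neg_atTop (sub_pos.2 hγ)).comp
      (tendsto_natCast_atTop_atTop (R := ℝ))).const_mul (C * 2 ^ β)
  refine squeeze_zero_norm' ?_ h1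
  filter_upwards [Filter.eventually_ge_atTop 1] with n hn
  have hn1 : (1 : ℝ) ≤ n := by exact_mod_cast hn
  have hn0 : (0 : ℝ) < n := by linarith
  rw [norm_div, Real.norm_of_nonneg (show 0 ≤ (n : ℝ) ^ γ by positivity),
    div_le_iff₀ (by positivity), mul_assoc, ← Real.rpow_add hn0,
    show -(γ - β) + γ = β by ring, mul_assoc, ← Real.mul_rpow (by norm_num) hn0.le]
  refine (hC n).trans ?_
  gcongr
  linarith

theorem PolyBdd.tendsto_div {β L : ℝ} (hβ : 0 ≤ β) (hβ' : β < 1) {x : ℕ → ℝ}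
    (h : PolyBdd β (fun n => x n - L * (n + 1))) :
    Filter.Tendsto (fun n : ℕ => x n / (n : ℝ)) Filter.atTop (nhds L) := by
  have h1 := h.tendsto_div_rpow hβ hβ'
  have h2 : Filter.Tendsto (fun n : ℕ => L + L * (n : ℝ)⁻¹) Filter.atTop (nhds (L + L * 0)) :=
    ((tendsto_inv_atTop_zero.comp (tendsto_natCast_atTop_atTop (R := ℝ))).const_mul L).const_add L
  have h3 := h1.add h2
  rw [mul_zero, add_zero, zero_add] at h3
  refine h3.congr' ?_
  filter_upwards [Filter.eventually_ge_atTop 1] with n hn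
  have hn0 : (n : ℝ) ≠ 0 := by exact_mod_cast (by omega : n ≠ 0)
  rw [Real.rpow_one]
  field_simp
  ring

theorem tendsto_gaussCf {m : ℕ} {L : ℝ}
    (h : Filter.Tendsto (fun n : ℕ => varSeq m n / (n : ℝ)) Filter.atTop (nhds L)) (t : ℝ) :
    Filter.Tendsto (fun n : ℕ => gaussCf m n (t / Real.sqrt n)) Filter.atTop
      (nhds ((Real.exp (-(L * t ^ 2) / 2) : ℝ) : ℂ)) := by
  refine (Complex.continuous_ofReal.tendsto _).comp ?_
  refine (Real.continuous_exp.tendsto _).comp ?_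
  refine ((h.mul_const (t ^ 2)).neg.div_const 2).congr fun n => ?_
  rw [div_pow, Real.sq_sqrt n.cast_nonneg]
  ring

theorem tendsto_abs_div_sqrt_rpow {p : ℝ} (hp : 2 < p) (t : ℝ) :
    Filter.Tendsto (fun n : ℕ => |t / Real.sqrt n| ^ p * ((n : ℝ) + 1)) Filter.atTop
      (nhds 0) := by
  have h1 : PolyBdd 1 (fun n : ℕ => |t| ^ p * ((n : ℝ) + 1)) := by
    refine ⟨|t| ^ p, fun n => ?_⟩
    rw [Real.rpow_one, Real.norm_of_nonneg (by positivity)]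
  refine (h1.tendsto_div_rpow (γ := p / 2) zero_le_one (by linarith)).congr fun n => ?_
  rw [abs_div, abs_of_nonneg (Real.sqrt_nonneg _), Real.div_rpow (abs_nonneg _)
    (Real.sqrt_nonneg _), Real.sqrt_eq_rpow, ← Real.rpow_mul n.cast_nonneg]
  ring_nf

theorem exists_tendsto_cf {m : ℕ} (hm : 2 ≤ m) (hm' : m ≤ 26) :
    ∃ L : ℝ, 0 < L ∧ (∀ t : ℝ, Filter.Tendsto (fun n : ℕ => cf m n (t / Real.sqrt n)) Filter.atTop
        (nhds ((Real.exp (-(L * t ^ 2) / 2) : ℝ) : ℂ))) ∧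
      Filter.Tendsto (fun n : ℕ => (meanProt m n - muProt m * n) / Real.sqrt n)
        Filter.atTop (nhds 0) := by
  obtain ⟨β, h0, h1, hβ⟩ := exists_isErrorExponent hm hm'
  have he := hβ β le_rfl (by linarith)
  have he2 := hβ (2 * β) (by linarith) (by linarith)
  obtain ⟨p, hp⟩ : ∃ p, p = min 3 (1 + 1 / (2 * β)) := ⟨_, rfl⟩
  have hp2 : 2 < p := by
    rw [hp, lt_min_iff]
    refine ⟨by norm_num, ?_⟩
    have : 1 < 1 / (2 * β) := by rw [lt_div_iff₀ (by positivity)]; linarith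
    linarith
  have hpβ : β * p < 1 := by
    have e : β * (1 + 1 / (2 * β)) = β + 1 / 2 := by field_simp
    have : β * p ≤ β * (1 + 1 / (2 * β)) := by
      rw [hp]; gcongr; exact min_le_right _ _
    linarith
  obtain ⟨C, hC⟩ := exists_norm_cf_sub_gaussCf_le hm h0 (by linarith) he he2 (p := p)
    (by linarith) (hp ▸ min_le_left _ _) hpβ (hβ _ (by nlinarith) hpβ)
  have hv := (he2 _ _ (isRecurrence_varSeq hm) (polyBdd_varToll hm h0.le he)).tendsto_div
    (by positivity) (by linarith)
  refine ⟨_, growthRate_varToll_pos hm h0 (by linarith) he, fun t => ?_, ?_⟩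
  · have hz : Filter.Tendsto (fun n : ℕ => cf m n (t / Real.sqrt n)
        - gaussCf m n (t / Real.sqrt n)) Filter.atTop (nhds 0) := by
      refine squeeze_zero_norm (fun n => hC n (t / Real.sqrt n)) ?_
      simpa [mul_assoc] using (tendsto_abs_div_sqrt_rpow hp2 t).const_mul C
    simpa using hz.add (tendsto_gaussCf hv t)
  · have hq : PolyBdd β (fun n => meanProt m n - muProt m * n) := by
      obtain ⟨D, hD⟩ := polyBdd_meanProt_sub hm h0.le he
      refine ⟨D + |muProt m|, fun n => ?_⟩
      have e : meanProt m n - muProt m * n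
          = (meanProt m n - muProt m * (n + 1)) + muProt m := by ring
      beta_reduce
      rw [e, add_mul]
      refine (norm_add_le _ _).trans (add_le_add (hD n) ?_)
      exact le_mul_of_one_le_right (abs_nonneg _) (one_le_add_one_rpow h0.le n)
    simpa [Real.sqrt_eq_rpow] using hq.tendsto_div_rpow h0.le h1

open MeasureTheory ProbabilityTheory in
/-- The law of a functional of the uniformly random permutation. -/
noncomputable def permLaw (n : ℕ) (W : Equiv.Perm (Fin n) → ℝ) : Measure ℝ :=
  ((n.factorial : NNReal)⁻¹) • ∑ π, Measure.dirac (W π)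

open MeasureTheory in
instance isProbabilityMeasure_permLaw (n : ℕ) (W : Equiv.Perm (Fin n) → ℝ) :
    IsProbabilityMeasure (permLaw n W) where
  measure_univ := by
    have h : (n.factorial : NNReal) ≠ 0 := by exact_mod_cast n.factorial_ne_zero
    have h2 : (n.factorial : ENNReal) ≠ 0 := by exact_mod_cast n.factorial_ne_zero
    simp [permLaw, Measure.finsetSum_apply, Fintype.card_perm, ENNReal.smul_def,
      ENNReal.coe_inv h, ENNReal.inv_mul_cancel h2]

open MeasureTheory in
theorem integral_permLaw {E : Type*} [NormedAddCommGroup E] [NormedSpace ℝ E] [CompleteSpace E]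
    (n : ℕ) (W : Equiv.Perm (Fin n) → ℝ) (f : ℝ → E) :
    ∫ x, f x ∂permLaw n W = (n.factorial : ℝ)⁻¹ • ∑ π, f (W π) := by
  rw [permLaw, integral_smul_nnreal_measure, integral_finsetSum_measure fun _ _ =>
    integrable_dirac (by simp)]
  simp [NNReal.smul_def]

open MeasureTheory ProbabilityTheory in
/-- A form of Lévy's continuity theorem for uniformly random permutations. -/
theorem tendstoGauss_of_charFun {W : (n : ℕ) → Equiv.Perm (Fin n) → ℝ} {v : NNReal}
    (h : ∀ t : ℝ, Filter.Tendsto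
      (fun n => (∑ π, Complex.exp (((t * W n π : ℝ) : ℂ) * Complex.I)) / (n.factorial : ℂ))
      Filter.atTop (nhds ((Real.exp (-(v * t ^ 2) / 2) : ℝ) : ℂ))) :
    TendstoGauss W v := by
  obtain ⟨μ, hμ⟩ : ∃ μ : ℕ → ProbabilityMeasure ℝ, μ = fun n => ⟨permLaw n (W n), inferInstance⟩ :=
    ⟨_, rfl⟩
  obtain ⟨ν, hν⟩ : ∃ ν : ProbabilityMeasure ℝ, ν = ⟨gaussianReal 0 v, inferInstance⟩ := ⟨_, rfl⟩
  have ht : Filter.Tendsto μ Filter.atTop (nhds ν) := by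
    refine ProbabilityMeasure.tendsto_iff_tendsto_charFun.2 fun t => ?_
    have e : charFun (ν : Measure ℝ) t = ((Real.exp (-(v * t ^ 2) / 2) : ℝ) : ℂ) := by
      rw [hν]
      change charFun (gaussianReal 0 v) t = _
      rw [charFun_gaussianReal]
      push_cast
      congr 1
      ring
    rw [e]
    refine (h t).congr fun n => ?_
    rw [hμ]
    change _ = charFun (permLaw n (W n)) t
    rw [charFun_apply_real, integral_permLaw, Complex.real_smul, div_eq_inv_mul]
    push_cast
    rfl
  intro f
  have h1 := ProbabilityMeasure.tendsto_iff_forall_integral_tendsto.1 ht f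
  rw [hμ, hν] at h1
  refine h1.congr fun n => ?_
  change ∫ x, f x ∂permLaw n (W n) = _
  rw [integral_permLaw, pexp, smul_eq_mul, div_eq_inv_mul]

theorem sum_exp_div_factorial (m n : ℕ) (t a : ℝ) :
    (∑ π, Complex.exp (((t * (((protCount (mst m n π) : ℝ) - a) / Real.sqrt n) : ℝ) : ℂ)
        * Complex.I)) / (n.factorial : ℂ)
      = cf m n (t / Real.sqrt n)
        * Complex.exp (((t * ((meanProt m n - a) / Real.sqrt n) : ℝ) : ℂ) * Complex.I) := by
  rw [cf, treeAvg_eq_sum, div_mul_eq_mul_div, Finset.sum_mul]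
  congr 1
  refine Finset.sum_congr rfl fun π _ => ?_
  rw [← Complex.exp_add, ← add_mul, ← Complex.ofReal_add]
  congr 3
  ring

/-- **Theorem (protected nodes in random `m`-ary search trees, `m ≤ 26`).**
Let `Z_n` be the number of protected nodes in the random `m`-ary search tree `𝒯_n`
with `n` keys. Then `n^{-1/2}(Z_n - E Z_n) → N(0, σ²)` for some `σ² > 0`; moreover
`E Z_n` can be replaced by `μ·n` with
`μ = (1/(m(H_m−1))) Σ_{ℓ=0}^{m−1} (m!/(m−ℓ)!)·((m(m−ℓ))!/(m(m−ℓ)+ℓ+1)!)`, i.e.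
`E Z_n = μ n + o(n^{1/2})`. -/
theorem protected_nodes_clt (m : ℕ) (hm : 2 ≤ m) (hm' : m ≤ 26) :
    ∃ σ2 : NNReal, 0 < σ2 ∧
      TendstoGauss (fun n π =>
        ((protCount (mst m n π) : ℝ)
            - pexp n (fun π' => (protCount (mst m n π') : ℝ))) / Real.sqrt n) σ2 ∧
      TendstoGauss (fun n π =>
        ((protCount (mst m n π) : ℝ) - muProt m * (n : ℝ)) / Real.sqrt n) σ2 ∧
      Asymptotics.IsLittleO Filter.atTop
        (fun n : ℕ => pexp n (fun π => (protCount (mst m n π) : ℝ)) - muProt m * (n : ℝ))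
        (fun n : ℕ => Real.sqrt n) := by
  obtain ⟨L, hL, hcf, hmean⟩ := exists_tendsto_cf hm hm'
  refine ⟨⟨L, hL.le⟩, hL, tendstoGauss_of_charFun fun t => ?_,
    tendstoGauss_of_charFun fun t => ?_, ?_⟩
  · refine (hcf t).congr fun n => ?_
    rw [sum_exp_div_factorial, meanProt]
    simp
  · have h1 : Filter.Tendsto (fun n : ℕ => Complex.exp
        (((t * ((meanProt m n - muProt m * n) / Real.sqrt n) : ℝ) : ℂ) * Complex.I))
        Filter.atTop (nhds 1) := by
      have hc : Continuous fun x : ℝ => Complex.exp (((t * x : ℝ) : ℂ) * Complex.I) := by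
        fun_prop
      have h2 := (hc.tendsto 0).comp hmean
      rw [mul_zero, Complex.ofReal_zero, zero_mul, Complex.exp_zero] at h2
      exact h2
    have h2 := (hcf t).mul h1
    rw [mul_one] at h2
    exact h2.congr fun n => (sum_exp_div_factorial m n t _).symm
  · refine (Asymptotics.isLittleO_iff_tendsto' ?_).2 hmean
    filter_upwards [Filter.eventually_ge_atTop 1] with n hn h0
    have hn0 : (0 : ℝ) < n := by exact_mod_cast hn
    exact absurd h0 (Real.sqrt_pos.2 hn0).ne'

end MSTpaper
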